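/- Let k be a field of characteristic 3 and let G = Sym(6) be the symmetric group on 6 letters. Then every simple kG-module is algebraic. -/

import Mathlib

open CategoryTheory CategoryTheory.MonoidalCategory

namespace AlgebraicModule

variable {k G : Type} [Field k] [Monoid G]

/-- `N` is a direct summand of `M`, i.e. a retract of `M`. -/
def IsSummand (N M : FDRep k G) : Prop :=
  ∃ (i : N ⟶ M) (r : M ⟶ N), i ≫ r = 𝟙 N

/-- `M` is an indecomposable module: it is nonzero and is not the direct sum of two
nonzero submodules (equivalently, its only idempotent endomorphisms are `0` and `1`). -/
def Indecomposable (M : FDRep k G) : Prop :=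
  ¬ Limits.IsZero M ∧ ∀ e : M ⟶ M, e ≫ e = e → e = 0 ∨ e = 𝟙 M

/-- `tensorPow M n` is the tensor power `M^{⊗ (n + 1)}`, with diagonal `G`-action. -/
noncomputable def tensorPow (M : FDRep k G) : ℕ → FDRep k G
  | 0 => M
  | n + 1 => tensorPow M n ⊗ M

/-- `M` is algebraic: only finitely many isomorphism classes of indecomposable modules
occur as direct summands of the tensor powers `M^{⊗ n}` for `n ≥ 1`. -/
noncomputable def IsAlgebraic (M : FDRep k G) : Prop :=
  ∃ L : List (FDRep k G), ∀ N : FDRep k G, Indecomposable N →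
    (∃ n : ℕ, IsSummand N (tensorPow M n)) → ∃ N' ∈ L, Nonempty (N ≅ N')

end AlgebraicModule

open AlgebraicModule

namespace AlgMod

section Cat
variable {C : Type*} [Category C] [Preadditive C]

/-- endomorphisms (morphisms) factoring through sums of objects in `S` -/
def Thru (S : C → Prop) (Z Z' : C) : AddSubgroup (Z ⟶ Z') :=
  AddSubgroup.closure {f | ∃ X, S X ∧ ∃ (i : Z ⟶ X) (r : X ⟶ Z'), f = i ≫ r}

/-- `Z` lies in `add S`. -/
def InAdd (S : C → Prop) (Z : C) : Prop := 𝟙 Z ∈ Thru S Z Z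

lemma Thru.of {S : C → Prop} {Z Z' X : C} (h : S X) (i : Z ⟶ X) (r : X ⟶ Z') :
    i ≫ r ∈ Thru S Z Z' := AddSubgroup.subset_closure ⟨X, h, i, r, rfl⟩

lemma Thru.comp {S : C → Prop} {A Z Z' B : C} {f : Z ⟶ Z'} (hf : f ∈ Thru S Z Z')
    (a : A ⟶ Z) (b : Z' ⟶ B) : a ≫ f ≫ b ∈ Thru S A B := by
  unfold Thru at hf
  induction hf using AddSubgroup.closure_induction with
  | mem x hx =>
    obtain ⟨X, hX, i, r, rfl⟩ := hx
    have := Thru.of hX (a ≫ i) (r ≫ b)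
    simpa using this
  | zero => simp [zero_mem]
  | add x y _ _ hx hy =>
    rw [Preadditive.add_comp, Preadditive.comp_add]; exact add_mem hx hy
  | neg x _ hx =>
    rw [Preadditive.neg_comp, Preadditive.comp_neg]; exact neg_mem hx

lemma InAdd.thru {S : C → Prop} {X A B : C} (h : InAdd S X) (a : A ⟶ X) (b : X ⟶ B) :
    a ≫ b ∈ Thru S A B := by
  have := Thru.comp h a b
  simpa using this

lemma InAdd.of {S : C → Prop} {X : C} (h : S X) : InAdd S X := by
  have := Thru.of h (𝟙 X) (𝟙 X)
  simpa [InAdd] using this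

lemma InAdd.retract {S : C → Prop} {Z X : C} (h : InAdd S X) (i : Z ⟶ X) (r : X ⟶ Z)
    (e : i ≫ r = 𝟙 Z) : InAdd S Z := by
  have := h.thru i r
  rwa [e] at this

lemma InAdd.iso {S : C → Prop} {Z X : C} (h : InAdd S X) (e : Z ≅ X) : InAdd S Z :=
  h.retract e.hom e.inv e.hom_inv_id

lemma Thru.functor {D : Type*} [Category D] [Preadditive D] (F : C ⥤ D) [F.Additive]
    {S : C → Prop} {S' : D → Prop} (hS : ∀ X, S X → InAdd S' (F.obj X)) {Z Z' : C}
    {f : Z ⟶ Z'} (hf : f ∈ Thru S Z Z') : F.map f ∈ Thru S' (F.obj Z) (F.obj Z') := by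
  unfold Thru at hf
  induction hf using AddSubgroup.closure_induction with
  | mem x hx =>
    obtain ⟨X, hX, i, r, rfl⟩ := hx
    rw [F.map_comp]
    exact (hS X hX).thru _ _
  | zero => rw [F.map_zero]; exact zero_mem _
  | add x y _ _ hx hy => rw [F.map_add]; exact add_mem hx hy
  | neg x _ hx => rw [F.map_neg]; exact neg_mem hx

lemma InAdd.functor {D : Type*} [Category D] [Preadditive D] (F : C ⥤ D) [F.Additive]
    {S : C → Prop} {S' : D → Prop} (hS : ∀ X, S X → InAdd S' (F.obj X)) {Z : C}
    (hf : InAdd S Z) : InAdd S' (F.obj Z) := by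
  have := Thru.functor F hS hf
  rwa [F.map_id] at this

lemma InAdd.trans {S S' : C → Prop} (hS : ∀ X, S X → InAdd S' X) {Z : C}
    (hf : InAdd S Z) : InAdd S' Z :=
  InAdd.functor (𝟭 C) hS hf

lemma InAdd.tensorRight [MonoidalCategory C] [MonoidalPreadditive C] {S S' : C → Prop} (V : C)
    (hS : ∀ X, S X → InAdd S' (X ⊗ V)) {Z : C}
    (hf : InAdd S Z) : InAdd S' (Z ⊗ V) :=
  InAdd.functor (CategoryTheory.MonoidalCategory.tensorRight V) hS hf

lemma InAdd.tensorLeft [MonoidalCategory C] [MonoidalPreadditive C] {S S' : C → Prop} (V : C)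
    (hS : ∀ X, S X → InAdd S' (V ⊗ X)) {Z : C}
    (hf : InAdd S Z) : InAdd S' (V ⊗ Z) :=
  InAdd.functor (CategoryTheory.MonoidalCategory.tensorLeft V) hS hf

end Cat

section FD
variable {k G : Type} [Field k] [Monoid G]

/-- the linear map underlying a morphism -/
def lin {V W : FDRep k G} (f : V ⟶ W) : V →ₗ[k] W := f.hom.hom.hom

lemma lin_comm {V W : FDRep k G} (f : V ⟶ W) (g : G) (v : V) :
    lin f (V.ρ g v) = W.ρ g (lin f v) := by
  have := congrArg (fun h => h.hom.hom v) (f.comm g)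
  exact this

/-- build a morphism from an equivariant linear map -/
def mkHom {V W : FDRep k G} (f : V →ₗ[k] W) (h : ∀ g v, f (V.ρ g v) = W.ρ g (f v)) : V ⟶ W where
  hom := FGModuleCat.ofHom f
  comm g := by
    ext v
    exact h g v

@[simp] lemma lin_mkHom {V W : FDRep k G} (f : V →ₗ[k] W) (h) : lin (mkHom f h) = f := rfl
lemma lin_id (V : FDRep k G) : lin (𝟙 V) = LinearMap.id := rfl
lemma lin_comp {V W X : FDRep k G} (f : V ⟶ W) (g : W ⟶ X) : lin (f ≫ g) = lin g ∘ₗ lin f := rfl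
lemma lin_add {V W : FDRep k G} (f g : V ⟶ W) : lin (f + g) = lin f + lin g := rfl
lemma lin_zero {V W : FDRep k G} : lin (0 : V ⟶ W) = 0 := rfl
lemma lin_inj {V W : FDRep k G} {f g : V ⟶ W} (h : lin f = lin g) : f = g := by
  apply Action.Hom.ext
  exact FGModuleCat.hom_ext h

lemma rho_tensor (V W : FDRep k G) (g : G) :
    (V ⊗ W : FDRep k G).ρ g = TensorProduct.map (V.ρ g) (W.ρ g) := rfl


end FD
end AlgMod
namespace AlgMod

section Ring

lemma fitting_ring {k A : Type*} [Field k] [Ring A] [Algebra k A] [FiniteDimensional k A]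
    (hA : ∀ e : A, e * e = e → e = 0 ∨ e = 1) (f : A) : IsUnit f ∨ IsUnit (1 - f) := by
  obtain ⟨n, g, hfg, hn⟩ : ∃ (n : ℕ) (g : A), Commute f g ∧ f ^ n = f ^ (n + 1) * g := by
    have hi : IsIntegral k f := IsIntegral.of_finite k f
    have hp := minpoly.ne_zero hi
    obtain ⟨q, hq, hq'⟩ := Polynomial.exists_eq_pow_rootMultiplicity_mul_and_not_dvd
      (minpoly k f) hp 0
    set n := Polynomial.rootMultiplicity 0 (minpoly k f)
    rw [Polynomial.C_0, sub_zero] at hq hq'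
    have hc : q.coeff 0 ≠ 0 := by
      rwa [Polynomial.X_dvd_iff] at hq'
    have h0 : Polynomial.aeval f (minpoly k f) = 0 := minpoly.aeval k f
    rw [hq] at h0
    have hq2 := Polynomial.divX_mul_X_add q
    rw [← hq2] at h0
    simp only [map_mul, map_pow, map_add, Polynomial.aeval_X, Polynomial.aeval_C] at h0
    have hcom : Commute f (Polynomial.aeval f q.divX) := by
      have := Polynomial.commute_X q.divX
      have h2 := this.map (Polynomial.aeval f : Polynomial k →ₐ[k] A)
      simpa using h2
    refine ⟨n, -((q.coeff 0)⁻¹ • Polynomial.aeval f q.divX), ?_, ?_⟩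
    · exact (hcom.smul_right _).neg_right
    · have h1 : (q.coeff 0) • f ^ n = - (f ^ (n + 1) * Polynomial.aeval f q.divX) := by
        rw [mul_add, ← hcom.eq, ← mul_assoc, ← pow_succ, ← Algebra.commutes,
          ← Algebra.smul_def] at h0
        exact eq_neg_of_add_eq_zero_right h0
      have h2 : f ^ n = (q.coeff 0)⁻¹ • ((q.coeff 0) • f ^ n) := by
        rw [smul_smul, inv_mul_cancel₀ hc, one_smul]
      rw [h2, h1]
      simp
  have hstep : ∀ m : ℕ, f ^ n = f ^ (n + m) * g ^ m := by
    intro m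
    induction m with
    | zero => simp
    | succ m ih =>
      have e1 : f ^ (n + (m + 1)) = f ^ (n + 1) * f ^ m := by rw [← pow_add]; congr 1; omega
      rw [e1, pow_succ' g m, mul_assoc, ← mul_assoc (f ^ m), (hfg.pow_left m).eq, mul_assoc,
        ← mul_assoc, ← hn, ← mul_assoc, ← pow_add, ← ih]
  have hidem : (f ^ n * g ^ n) * (f ^ n * g ^ n) = f ^ n * g ^ n := by
    have hc := (hfg.pow_pow n n)
    rw [mul_assoc, ← mul_assoc (g ^ n), ← hc.eq, mul_assoc, ← mul_assoc, ← pow_add,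
      ← mul_assoc, ← hstep n]
  rcases hA _ hidem with h | h
  · right
    have : f ^ n = 0 := by
      rw [hstep n, pow_add, mul_assoc, h, mul_zero]
    exact IsNilpotent.isUnit_one_sub ⟨n, this⟩
  · left
    have h1 : f * (g * f ^ n * g ^ n) = 1 := by
      rw [← mul_assoc, ← mul_assoc, mul_assoc f g, ← (hfg.pow_left n).eq, ← mul_assoc,
        ← pow_succ', ← hn, h]
    have hcomm : Commute f (g * f ^ n * g ^ n) :=
      (hfg.mul_right (Commute.self_pow f n)).mul_right (hfg.pow_right n)
    exact ⟨⟨f, _, h1, by rw [← hcomm.eq, h1]⟩, rfl⟩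

lemma local_add {A : Type*} [Ring A] (hA : ∀ f : A, IsUnit f ∨ IsUnit (1 - f)) (x y : A)
    (h : IsUnit (x + y)) : IsUnit x ∨ IsUnit y := by
  obtain ⟨u, hu⟩ := h
  rcases hA (↑u⁻¹ * x) with h | h
  · left
    have := u.isUnit.mul h
    simpa using this
  · right
    have h2 : (1 : A) - ↑u⁻¹ * x = ↑u⁻¹ * y := by
      have : (↑u⁻¹ : A) * (x + y) = 1 := by rw [← hu]; simp
      rw [mul_add] at this
      rw [← this]; abel
    rw [h2] at h
    have := u.isUnit.mul h
    simpa using this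
end Ring

section FD
variable {k G : Type} [Field k] [Monoid G]

lemma indec_local {N : FDRep k G} (hN : AlgebraicModule.Indecomposable N) (f : End N) :
    IsUnit f ∨ IsUnit (1 - f) := by
  have : FiniteDimensional k (End N) := inferInstanceAs (FiniteDimensional k (N ⟶ N))
  exact fitting_ring (k := k) (A := End N) (fun e he => hN.2 e he) f

lemma indec_nontrivial {N : FDRep k G} (hN : AlgebraicModule.Indecomposable N) : ¬ IsUnit (0 : End N) := by
  intro h
  apply hN.1
  rw [isUnit_zero_iff] at h
  exact (Limits.IsZero.iff_id_eq_zero N).2 h.symm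

/-- an indecomposable object of `add S` is a retract of an object of `S`. -/
lemma indec_retract {N : FDRep k G} (hN : AlgebraicModule.Indecomposable N) {S : FDRep k G → Prop}
    (h : InAdd S N) : ∃ X, S X ∧ IsSummand N X := by
  by_contra hcon
  have key : ∀ f ∈ Thru S N N, ¬ IsUnit (M := End N) f := by
    intro f hf
    unfold Thru at hf
    induction hf using AddSubgroup.closure_induction with
    | mem x hx =>
      obtain ⟨X, hX, i, r, rfl⟩ := hx
      rintro ⟨u, hu⟩
      apply hcon
      refine ⟨X, hX, i, r ≫ (↑u⁻¹ : End N), ?_⟩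
      rw [← Category.assoc, ← hu]
      exact u.inv_mul
    | zero => exact indec_nontrivial hN
    | add x y _ _ hx hy =>
      intro h
      rcases local_add (indec_local hN) (x : End N) y h with h | h
      · exact hx h
      · exact hy h
    | neg x _ hx =>
      intro h
      apply hx
      have h2 := IsUnit.neg (α := End N) h
      rwa [neg_neg] at h2
  exact key _ h (isUnit_one (M := End N))

/-- image of an idempotent -/
lemma split_idem (X : FDRep k G) (e : X ⟶ X) (he : e ≫ e = e) (h1 : e ≠ 𝟙 X) :
    ∃ (Y : FDRep k G) (i : Y ⟶ X) (p : X ⟶ Y), p ≫ i = e ∧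
      Module.finrank k Y < Module.finrank k X := by
  let R := LinearMap.range (lin e)
  have hR : ∀ g, ∀ v ∈ R, X.ρ g v ∈ R := by
    rintro g _ ⟨w, rfl⟩
    exact ⟨X.ρ g w, lin_comm e g w⟩
  let σ : Representation k G R :=
    { toFun := fun g => (X.ρ g).restrict (hR g)
      map_one' := by ext v; simp
      map_mul' := by intro a b; ext v; simp }
  refine ⟨FDRep.of σ, mkHom R.subtype (fun g v => rfl),
    mkHom (LinearMap.rangeRestrict (lin e)) (fun g v => Subtype.ext (lin_comm e g v)),
    lin_inj rfl, ?_⟩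
  have : R ≠ ⊤ := by
    intro htop
    apply h1
    apply lin_inj
    ext v
    have hv : v ∈ R := by rw [htop]; trivial
    obtain ⟨w, rfl⟩ := hv
    exact congrArg (fun f => lin f w) he
  exact Submodule.finrank_lt this

lemma finite_summands : ∀ (n : ℕ) (X : FDRep k G), Module.finrank k X ≤ n →
    ∃ L : List (FDRep k G), ∀ N : FDRep k G, AlgebraicModule.Indecomposable N → IsSummand N X →
      ∃ N' ∈ L, Nonempty (N ≅ N') := by
  intro n
  induction n with
  | zero =>
    intro X hX
    refine ⟨[], fun N hN ⟨i, r, hir⟩ => ?_⟩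
    exfalso
    apply hN.1
    rw [Limits.IsZero.iff_id_eq_zero, ← hir]
    have : i = 0 := by
      apply lin_inj
      ext v
      have : Subsingleton X := by
        rw [← Module.finrank_zero_iff (R := k)]; omega
      exact Subsingleton.elim (α := X) _ _
    rw [this, Limits.zero_comp]
  | succ n ih =>
    intro X hX
    by_cases hind : ∀ e : X ⟶ X, e ≫ e = e → e = 0 ∨ e = 𝟙 X
    · refine ⟨[X], fun N hN ⟨i, r, hir⟩ => ⟨X, by simp, ?_⟩⟩
      have hid : (r ≫ i) ≫ (r ≫ i) = r ≫ i := by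
        rw [Category.assoc, ← Category.assoc i, hir, Category.id_comp]
      rcases hind _ hid with h | h
      · exfalso
        apply hN.1
        rw [Limits.IsZero.iff_id_eq_zero]
        calc 𝟙 N = i ≫ (r ≫ i) ≫ r := by
              rw [Category.assoc, ← Category.assoc i, hir, Category.id_comp]
          _ = 0 := by rw [h]; simp
      · exact ⟨⟨i, r, hir, h⟩⟩
    · push Not at hind
      obtain ⟨e, he, h0, h1⟩ := hind
      obtain ⟨Y, i, p, hpi, hd⟩ := split_idem X e he h1
      have he' : (𝟙 X - e) ≫ (𝟙 X - e) = 𝟙 X - e := by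
        simp [Preadditive.sub_comp, Preadditive.comp_sub, he]
      obtain ⟨Y', i', p', hpi', hd'⟩ := split_idem X (𝟙 X - e) he' (by
        intro h; apply h0; simpa using h)
      obtain ⟨L, hL⟩ := ih Y (by omega)
      obtain ⟨L', hL'⟩ := ih Y' (by omega)
      refine ⟨L ++ L', fun N hN ⟨a, b, hab⟩ => ?_⟩
      have hin : InAdd (fun Z => Z = Y ∨ Z = Y') N := by
        have h2 : 𝟙 N = (a ≫ p) ≫ (i ≫ b) + (a ≫ p') ≫ (i' ≫ b) := by
          have : (𝟙 X : X ⟶ X) = p ≫ i + p' ≫ i' := by rw [hpi, hpi']; simp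
          calc 𝟙 N = a ≫ 𝟙 X ≫ b := by simp [hab]
            _ = _ := by rw [this]; simp
        unfold InAdd
        rw [h2]
        exact add_mem (Thru.of (S := fun Z => Z = Y ∨ Z = Y') (Or.inl rfl) _ _)
          (Thru.of (S := fun Z => Z = Y ∨ Z = Y') (Or.inr rfl) _ _)
      obtain ⟨Z, hZ, hs⟩ := indec_retract hN hin
      rcases hZ with rfl | rfl
      · obtain ⟨N', h, h'⟩ := hL N hN hs
        exact ⟨N', by simp [h], h'⟩
      · obtain ⟨N', h, h'⟩ := hL' N hN hs
        exact ⟨N', by simp [h], h'⟩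

/-- criterion -/
lemma isAlgebraic_of_inAdd (M : FDRep k G) (L : List (FDRep k G))
    (h : ∀ n, InAdd (fun X => X ∈ L) (tensorPow M n)) : IsAlgebraic M := by
  choose F hF using fun X : FDRep k G => finite_summands (Module.finrank k X) X le_rfl
  refine ⟨L.flatMap F, fun N hN ⟨n, i, r, hir⟩ => ?_⟩
  obtain ⟨X, hX, hs⟩ := indec_retract hN ((h n).retract i r hir)
  obtain ⟨N', h1, h2⟩ := hF X N hN hs
  exact ⟨N', List.mem_flatMap.2 ⟨X, hX, h1⟩, h2⟩

end FD
end AlgMod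
namespace AlgMod
section Higman
variable {k G Γ : Type} [Field k] [Group G] [Monoid Γ]

/-- restriction along `φ` -/
noncomputable def resO (φ : Γ →* G) (N : FDRep k G) : FDRep k Γ := FDRep.of (N.ρ.comp φ)

/-- underlying map out of a restriction -/
noncomputable def linI {φ : Γ →* G} {N : FDRep k G} {X : FDRep k Γ} (i : resO φ N ⟶ X) : N →ₗ[k] X := lin i
/-- underlying map into a restriction -/
noncomputable def linR {φ : Γ →* G} {N : FDRep k G} {X : FDRep k Γ} (r : X ⟶ resO φ N) : X →ₗ[k] N := lin r
/-- underlying map of a restriction -/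
noncomputable def linRI {φ : Γ →* G} {N : FDRep k G} (r : resO φ N ⟶ resO φ N) : N →ₗ[k] N :=
  (lin r : resO φ N →ₗ[k] resO φ N)
lemma linI_comm {φ : Γ →* G} {N : FDRep k G} {X : FDRep k Γ} (i : resO φ N ⟶ X) (γ : Γ) (n : N) :
    linI i (N.ρ (φ γ) n) = X.ρ γ (linI i n) := lin_comm i γ n
lemma linR_comm {φ : Γ →* G} {N : FDRep k G} {X : FDRep k Γ} (i : X ⟶ resO φ N) (γ : Γ) (n : X) :
    linR i (X.ρ γ n) = N.ρ (φ γ) (linR i n) := lin_comm i γ n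

/-- the space of coinduced functions -/
def coindSub (φ : Γ →* G) (X : FDRep k Γ) : Submodule k (G → X) where
  carrier := {f | ∀ γ g, f (φ γ * g) = X.ρ γ (f g)}
  add_mem' := by
    intro a b ha hb γ g
    simp [ha γ g, hb γ g]
  zero_mem' := by intro γ g; simp
  smul_mem' := by
    intro c a ha γ g
    simp [ha γ g]

/-- coinduced representation -/
def coindRep (φ : Γ →* G) (X : FDRep k Γ) : Representation k G (coindSub φ X) where
  toFun g :=
    { toFun := fun f => ⟨fun x => f.1 (x * g), fun γ x => by
        change f.1 (φ γ * x * g) = X.ρ γ (f.1 (x * g))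
        rw [mul_assoc]; exact f.2 γ _⟩
      map_add' := fun _ _ => rfl
      map_smul' := fun _ _ => rfl }
  map_one' := by ext f x; simp
  map_mul' a b := by ext f x; simp [mul_assoc]

variable [Finite G]

/-- coinduced module -/
noncomputable def coind (φ : Γ →* G) (X : FDRep k Γ) : FDRep k G := 
  FDRep.of (coindRep φ X)

/-- the map into the coinduced module -/
noncomputable def hatI (φ : Γ →* G) {N : FDRep k G} {X : FDRep k Γ} (i : resO φ N ⟶ X) :
    N ⟶ coind φ X :=
  mkHom (W := coind φ X)
    (show N →ₗ[k] coindSub φ X from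
    { toFun := fun n => ⟨fun g => linI i (N.ρ g n), fun γ g => by
        change linI i (N.ρ (φ γ * g) n) = X.ρ γ (linI i (N.ρ g n))
        rw [map_mul]; exact linI_comm i γ (N.ρ g n)⟩
      map_add' := fun a b => by
        ext g
        change linI i (N.ρ g (a + b)) = linI i (N.ρ g a) + linI i (N.ρ g b)
        rw [map_add]; exact map_add (linI i) _ _
      map_smul' := fun c a => by
        ext g
        change linI i (N.ρ g (c • a)) = c • linI i (N.ρ g a)
        rw [map_smul]; exact map_smul (linI i) _ _ })
    (fun g v => by
      refine Subtype.ext (funext fun x => ?_)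
      change linI i (N.ρ x (N.ρ g v)) = linI i (N.ρ (x * g) v)
      rw [map_mul]; rfl)

variable (H : Subgroup G)

omit [Finite G] in
lemma sum_out_smul {A : Type*} [AddCommMonoid A] [Fintype (G ⧸ H)] (T : G → A)
    (hT : ∀ x, ∀ h ∈ H, T (x * h) = T x) (g : G) :
    ∑ q : G ⧸ H, T (g * q.out) = ∑ q : G ⧸ H, T q.out := by
  have h1 : ∀ x : G, T x = T ((x : G ⧸ H).out) := by
    intro x
    obtain ⟨h, hh⟩ := QuotientGroup.mk_out_eq_mul H x
    rw [hh, hT _ _ h.2]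
  rw [← Equiv.sum_comp (MulAction.toPerm g : Equiv.Perm (G ⧸ H)) (fun q => T q.out)]
  refine Finset.sum_congr rfl fun q _ => ?_
  rw [h1 (g * q.out)]
  congr 2
  rw [MulAction.toPerm_apply]
  conv_rhs => rw [← QuotientGroup.out_eq' q]
  rfl

variable (φ : Γ →* G) (hφ : ∀ h ∈ H, ∃ γ, φ γ = h)

include hφ in
lemma hatR_exists {N : FDRep k G} {X : FDRep k Γ} [Fintype (G ⧸ H)] (r : X ⟶ resO φ N) :
    ∃ R : coind φ X ⟶ N, ∀ f : coindSub φ X,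
      lin R f = ∑ q : G ⧸ H, N.ρ q.out (linR r (f.1 (q.out)⁻¹)) := by
  let R0 : coindSub φ X →ₗ[k] N := 
    { toFun := fun f => ∑ q : G ⧸ H, N.ρ q.out (linR r (f.1 (q.out)⁻¹))
      map_add' := fun a b => by
        rw [← Finset.sum_add_distrib]
        refine Finset.sum_congr rfl fun q _ => ?_
        rw [← map_add (N.ρ q.out), ← map_add (linR r)]
        rfl
      map_smul' := fun c a => by
        rw [RingHom.id_apply, Finset.smul_sum]
        refine Finset.sum_congr rfl fun q _ => ?_
        rw [← map_smul (N.ρ q.out), ← map_smul (linR r)]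
        rfl }
  refine ⟨mkHom (V := coind φ X) R0 ?_, fun f => rfl⟩
  intro g f
  change ∑ q : G ⧸ H, N.ρ q.out (linR r (f.1 ((q.out)⁻¹ * g))) =
    N.ρ g (∑ q : G ⧸ H, N.ρ q.out (linR r (f.1 (q.out)⁻¹)))
  have hT := sum_out_smul H (fun x => N.ρ x (linR r (f.1 (x⁻¹ * g)))) ?_ g
  · rw [← hT, map_sum]
    refine Finset.sum_congr rfl fun q _ => ?_
    simp only [map_mul, mul_inv_rev, inv_mul_cancel_right]
    rfl
  · intro x h hh
    obtain ⟨γ, hγ⟩ := hφ h⁻¹ (inv_mem hh)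
    have := f.2 γ (x⁻¹ * g)
    rw [hγ] at this
    simp only [mul_inv_rev, mul_assoc]
    rw [this, map_mul]
    change N.ρ x (N.ρ h (linR r (X.ρ γ _))) = _
    rw [linR_comm]
    rw [hγ, ← Module.End.mul_apply (N.ρ h), ← map_mul]
    simp

include hφ in
/-- Higman's criterion -/
theorem higman (hi : (H.index : k) ≠ 0) {N : FDRep k G} {S : FDRep k Γ → Prop}
    (h : InAdd S (resO φ N)) : InAdd (fun Y => ∃ X, S X ∧ Y = coind φ X) N := by
  classical
  have : Fintype (G ⧸ H) := Fintype.ofFinite _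
  have key : ∀ f ∈ Thru S (resO φ N) (resO φ N), ∃ F ∈ Thru (fun Y => ∃ X, S X ∧ Y = coind φ X) N N,
      ∀ n : N, lin F n = ∑ q : G ⧸ H, N.ρ q.out (linRI f (N.ρ (q.out)⁻¹ n)) := by
    intro f hf
    unfold Thru at hf
    induction hf using AddSubgroup.closure_induction with
    | mem x hx =>
      obtain ⟨X, hX, i, r, rfl⟩ := hx
      obtain ⟨R, hR⟩ := hatR_exists H φ hφ r
      refine ⟨hatI φ i ≫ R, Thru.of (S := fun Y => ∃ X, S X ∧ Y = coind φ X) ⟨X, hX, rfl⟩ _ _, ?_⟩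
      intro n
      exact hR _
    | zero =>
      refine ⟨0, zero_mem _, fun n => ?_⟩
      rw [lin_zero]
      symm
      refine Finset.sum_eq_zero fun q _ => ?_
      exact map_zero (N.ρ q.out)
    | add x y _ _ hx hy =>
      obtain ⟨F, hF, hF'⟩ := hx
      obtain ⟨F2, hF2, hF2'⟩ := hy
      refine ⟨F + F2, add_mem hF hF2, fun n => ?_⟩
      rw [lin_add, LinearMap.add_apply, hF', hF2', ← Finset.sum_add_distrib]
      refine Finset.sum_congr rfl fun q _ => ?_
      exact (map_add (N.ρ q.out) _ _).symm
    | neg x _ hx =>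
      obtain ⟨F, hF, hF'⟩ := hx
      refine ⟨-F, neg_mem hF, fun n => ?_⟩
      have : lin (-F) n = - lin F n := rfl
      rw [this, hF', ← Finset.sum_neg_distrib]
      refine Finset.sum_congr rfl fun q _ => ?_
      exact (map_neg (N.ρ q.out) _).symm
  obtain ⟨F, hF, hF'⟩ := key _ h
  have h2 : 𝟙 N = (mkHom (((H.index : k)⁻¹) • LinearMap.id) (fun g v => by simp) : N ⟶ N) ≫ F ≫ 𝟙 N := by
    rw [Category.comp_id]
    apply lin_inj
    ext n
    rw [lin_comp, LinearMap.comp_apply, hF', lin_id, lin_mkHom]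
    have : ∀ q : G ⧸ H, N.ρ q.out (linRI (𝟙 (resO φ N)) (N.ρ (q.out)⁻¹
        (((H.index : k)⁻¹ • LinearMap.id : N →ₗ[k] N) n))) = (H.index : k)⁻¹ • n := by
      intro q
      change N.ρ q.out (N.ρ (q.out)⁻¹ _) = _
      rw [← Module.End.mul_apply, ← map_mul]
      simp
    rw [Finset.sum_congr rfl (fun q _ => this q), Finset.sum_const, Finset.card_univ,
      ← Nat.card_eq_fintype_card, ← Subgroup.index, ← Nat.cast_smul_eq_nsmul k, smul_smul,
      mul_inv_cancel₀ hi, one_smul]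
    rfl
  unfold InAdd
  rw [h2]
  exact Thru.comp hF _ _

end Higman
end AlgMod
namespace AlgMod
section BC
variable {k K Γ : Type} [Field k] [Field K] [Algebra k K] [Monoid Γ]

/-- type synonym for restricted scalars -/
def RS (_k : Type) {K Γ : Type} [Field K] [Monoid Γ] (Z : FDRep K Γ) : Type := Z

instance (Z : FDRep K Γ) : AddCommGroup (RS k Z) := inferInstanceAs (AddCommGroup Z)
instance (Z : FDRep K Γ) : Module K (RS k Z) := inferInstanceAs (Module K Z)
instance (Z : FDRep K Γ) : FiniteDimensional K (RS k Z) := inferInstanceAs (FiniteDimensional K Z)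
instance (Z : FDRep K Γ) : Module k (RS k Z) := Module.compHom Z (algebraMap k K)
instance (Z : FDRep K Γ) : IsScalarTower k K (RS k Z) where
  smul_assoc c x z := by
    have : (algebraMap k K c * x) • (z : Z) = algebraMap k K c • x • (z : Z) := mul_smul _ _ _
    rw [← Algebra.smul_def] at this
    exact this

variable [FiniteDimensional k K]

instance (Z : FDRep K Γ) : FiniteDimensional k (RS k Z) :=
  Module.Finite.trans (R := k) (A := K) (M := RS k Z)

/-- restriction of scalars of a representation -/
noncomputable def rsRep (Z : FDRep K Γ) : Representation k Γ (RS k Z) where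
  toFun γ := LinearMap.restrictScalars k
    (show RS k Z →ₗ[K] RS k Z from Z.ρ γ)
  map_one' := by
    ext z
    exact congrArg (fun f : Z →ₗ[K] Z => f z) (map_one Z.ρ)
  map_mul' a b := by
    ext z
    exact congrArg (fun f : Z →ₗ[K] Z => f z) (map_mul Z.ρ a b)

variable (k) in
/-- restriction of scalars -/
noncomputable def rsF : FDRep K Γ ⥤ FDRep k Γ where
  obj Z := FDRep.of (rsRep (k := k) Z)
  map {Z Z'} f := mkHom (V := FDRep.of (rsRep (k := k) Z)) (W := FDRep.of (rsRep (k := k) Z'))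
    (LinearMap.restrictScalars k
      (show RS k Z →ₗ[K] RS k Z' from lin f))
    (fun γ z => lin_comm f γ z)
  map_id _ := lin_inj rfl
  map_comp _ _ := lin_inj rfl

instance : (rsF k : FDRep K Γ ⥤ FDRep k Γ).Additive where
  map_add := lin_inj rfl

/-- base change -/
noncomputable def bc (K : Type) [Field K] [Algebra k K] (M : FDRep k Γ) : FDRep K Γ :=
  FDRep.of (((Module.End.baseChangeHom k K M).toMonoidHom).comp M.ρ)

omit [FiniteDimensional k K] in
lemma bc_rho (M : FDRep k Γ) (γ : Γ) (c : K) (m : M) :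
    (bc K M).ρ γ (c ⊗ₜ[k] m : TensorProduct k K M) = (c ⊗ₜ[k] M.ρ γ m : TensorProduct k K M) := rfl

omit [FiniteDimensional k K] in
lemma bc_rho' (M : FDRep k Γ) (γ : Γ) : (bc K M).ρ γ = (M.ρ γ).baseChange K := rfl

/-- the projection formula -/
noncomputable def projIso (Z : FDRep K Γ) (M : FDRep k Γ) :
    (rsF k).obj Z ⊗ M ≅ (rsF k).obj (Z ⊗ bc K M) := by
  let e := TensorProduct.AlgebraTensorModule.cancelBaseChange k K K (RS k Z) M
  let f : TensorProduct k (RS k Z) M →ₗ[k]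
      (RS k (Z ⊗ bc K M)) :=
    { toFun := fun x => e.symm x
      map_add' := fun x y => map_add e.symm x y
      map_smul' := fun c x => by
        have := map_smul e.symm (algebraMap k K c) x
        rw [algebraMap_smul] at this
        exact this }
  let g : (RS k (Z ⊗ bc K M))
      →ₗ[k] TensorProduct k (RS k Z) M :=
    { toFun := fun x => e x
      map_add' := fun x y => map_add e x y
      map_smul' := fun c x => by
        have := map_smul e (algebraMap k K c) x
        rw [algebraMap_smul] at this
        exact this }
  have hfg : ∀ x, g (f x) = x := fun x => e.apply_symm_apply x
  have hgf : ∀ x, f (g x) = x := fun x => e.symm_apply_apply x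
  let ρ1 := fun γ => TensorProduct.map (rsRep (k := k) Z γ) (M.ρ γ)
  let ρ2 : Γ → (TensorProduct K (RS k Z) (TensorProduct k K M)) →ₗ[K]
     (TensorProduct K (RS k Z) (TensorProduct k K M)) := fun γ => TensorProduct.map (show RS k Z →ₗ[K] RS k Z from Z.ρ γ) ((M.ρ γ).baseChange K)
  have hf : ∀ γ (x : TensorProduct k (RS k Z) M), e.symm (ρ1 γ x) = ρ2 γ (e.symm x) := by
    intro γ x
    induction x using TensorProduct.induction_on with
    | zero => simp
    | add x y hx hy => simp only [map_add, hx, hy]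
    | tmul z m =>
      simp [e, ρ1, ρ2]
      rfl
  have hg : ∀ γ y, g (((rsF k).obj (Z ⊗ bc K M)).ρ γ y) = ρ1 γ (g y) := by
    intro γ y
    have h1 := hf γ (g y)
    have h2 : e.symm (g y) = y := hgf y
    have h3 : e (e.symm (ρ1 γ (g y))) = e (ρ2 γ y) := by
      rw [h1, h2]
    rw [e.apply_symm_apply] at h3
    exact h3.symm
  exact
    { hom := mkHom (V := (rsF k).obj Z ⊗ M) (W := (rsF k).obj (Z ⊗ bc K M)) f (fun γ x => hf γ x)
      inv := mkHom (W := (rsF k).obj Z ⊗ M) (V := (rsF k).obj (Z ⊗ bc K M)) g hg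
      hom_inv_id := lin_inj (LinearMap.ext hfg)
      inv_hom_id := lin_inj (LinearMap.ext hgf) }

/-- M is a summand of the restriction of its base change -/
lemma inAdd_bc (M : FDRep k Γ) : InAdd (fun X => X = (rsF k).obj (bc K M)) M := by
  have : FiniteDimensional k (TensorProduct k K M) := Module.Finite.tensorProduct k K M
  obtain ⟨f, hf⟩ := LinearMap.exists_leftInverse_of_injective
    (Algebra.linearMap k K) (LinearMap.ker_eq_bot.2 (algebraMap k K).injective)
  let i : M →ₗ[k] TensorProduct k K M := TensorProduct.mk k K M 1
  let r : TensorProduct k K M →ₗ[k] M := (TensorProduct.lid k M).toLinearMap ∘ₗ (TensorProduct.map f LinearMap.id)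
  have hsm : ∀ (c : k) (t : TensorProduct k K M), algebraMap k K c • t = c • t := fun c t => algebraMap_smul K c t
  let i' : M ⟶ (rsF k).obj (bc K M) := mkHom (W := (rsF k).obj (bc K M))
    (show M →ₗ[k] RS k (bc K M) from
    { toFun := i
      map_add' := map_add i
      map_smul' := fun c m => by
        have := map_smul i c m
        rw [← hsm] at this
        exact this }) (fun γ v => by
          rfl)
  let r' : (rsF k).obj (bc K M) ⟶ M := mkHom (V := (rsF k).obj (bc K M))
    (show RS k (bc K M) →ₗ[k] M from
    { toFun := r
      map_add' := map_add r
      map_smul' := fun c (m : TensorProduct k K M) => by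
        have := map_smul r c (m : TensorProduct k K M)
        rw [← hsm c (m : TensorProduct k K M)] at this
        exact this }) (fun γ v => by
          change r ((M.ρ γ).baseChange K v) = M.ρ γ (r v)
          induction v using TensorProduct.induction_on with
          | zero => simp
          | add x y hx hy => simp only [map_add, hx, hy]
          | tmul c m => simp [r])
  refine (InAdd.of (S := fun X => X = (rsF k).obj (bc K M)) rfl).retract i' r' ?_
  apply lin_inj
  ext m
  have h1 : f 1 = 1 := by
    have := LinearMap.congr_fun hf 1
    simpa using this
  change r (i m) = m
  simp [r, i, h1]

/-- descent -/
theorem bc_tensorPow (M : FDRep k Γ) (S : FDRep K Γ → Prop) (h0 : InAdd S (bc K M))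
    (h1 : ∀ X, S X → InAdd S (X ⊗ bc K M)) (n : ℕ) :
    InAdd (fun Y => ∃ X, S X ∧ Y = (rsF k).obj X) (tensorPow M n) := by
  have hF : ∀ X : FDRep K Γ, InAdd S X → InAdd (fun Y => ∃ X, S X ∧ Y = (rsF k).obj X) ((rsF k).obj X) := by
    intro X hX
    exact InAdd.functor (rsF k) (fun Z hZ => InAdd.of (S := fun Y => ∃ X, S X ∧ Y = (rsF k).obj X) ⟨Z, hZ, rfl⟩) hX
  induction n with
  | zero =>
    refine InAdd.trans ?_ (inAdd_bc (K := K) M)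
    rintro _ rfl
    exact hF _ h0
  | succ n ih =>
    refine InAdd.tensorRight M ?_ ih
    rintro _ ⟨X, hX, rfl⟩
    exact (hF _ (h1 X hX)).iso (projIso X M)

end BC
end AlgMod
namespace AlgMod
section F9
/-- addition in the field of nine elements, on codes -/
def ad (a b : ℕ) : ℕ := (8986690708024339884259668388453865091868182506470258411551265922896781674643265104972283578167824 >>> (4 * (9 * (a % 9) + b % 9))) % 16
/-- multiplication in the field of nine elements, on codes -/
def ml (a b : ℕ) : ℕ := (12992295474418726299168584010125499800446975643965808714274855111902658395364003326119775607717888 >>> (4 * (9 * (a % 9) + b % 9))) % 16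
/-- lazy multiplication -/
def lz (a b : ℕ) : ℕ := Nat.casesOn a 0 (fun n => ml (n + 1) b)
/-- sums of codes -/
def gs : ℕ → (ℕ → ℕ) → ℕ
  | 0, _ => 0
  | n + 1, f => ad (f n) (gs n f)
/-- bounded quantifier -/
def al : ℕ → (ℕ → Bool) → Bool
  | 0, _ => true
  | n + 1, f => and (f n) (al n f)
/-- Kronecker product of coded matrices -/
def kr (N : ℕ) (α β : ℕ → ℕ → ℕ) (p q : ℕ) : ℕ := lz (β (p % N) (q % N)) (α (p / N) (q / N))
/-- unipotent matrices -/
def un (s : ℕ) (p q : ℕ) : ℕ := cond (Nat.beq p q) 1 (cond (Nat.ble p q) s 0)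
/-- intertwiner check -/
def okc (N M : ℕ) (α α' P : ℕ → ℕ → ℕ) : Bool :=
  al M fun i => al N fun j => 
    Nat.beq (gs N (fun l => lz (P i l) (α l j))) (gs M (fun l => lz (P l j) (α' i l)))
end F9

section Pw
variable {C : Type*} [Category C] [Preadditive C] [MonoidalCategory C] [MonoidalPreadditive C]
  [BraidedCategory C]

/-- tensor powers -/
def pw (A : C) : ℕ → C
  | 0 => 𝟙_ C
  | n + 1 => pw A n ⊗ A

/-- the finite family -/
def Fam (A B X : C) : Prop := ∃ i ≤ 4, ∃ j ≤ 4, X = pw A i ⊗ pw B j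

/-- moving a factor -/
def isoA (X Y A : C) : (X ⊗ Y) ⊗ A ≅ (X ⊗ A) ⊗ Y :=
  α_ X Y A ≪≫ whiskerLeftIso X (β_ Y A) ≪≫ (α_ X A Y).symm

/-- moving the second factor -/
def isoB (X B : C) (j : ℕ) : (X ⊗ B) ⊗ pw B j ≅ X ⊗ pw B (j + 1) :=
  (isoA X (pw B j) B).symm ≪≫ α_ _ _ _

/-- the key relation -/
def KeyRel (A B : C) : Prop := InAdd (fun X => X = pw A 3 ∨ X = pw A 2 ⊗ B) (pw A 5)

variable {A B : C} (hA : KeyRel A B) (hB : KeyRel B A)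

include hA in
lemma good_a {m : ℕ} {T : C → Prop} (h3 : InAdd T (pw A 3 ⊗ pw B m))
    (h2 : InAdd T (pw A 2 ⊗ pw B (m + 1))) : InAdd T (pw A 5 ⊗ pw B m) := by
  refine InAdd.tensorRight _ ?_ hA
  rintro _ (rfl | rfl)
  · exact h3
  · exact h2.iso (isoB _ _ _)

include hB in
lemma good_b {n : ℕ} {T : C → Prop} (h3 : InAdd T (pw A n ⊗ pw B 3))
    (h2 : InAdd T (pw A (n + 1) ⊗ pw B 2)) : InAdd T (pw A n ⊗ pw B 5) := by
  refine InAdd.tensorLeft _ ?_ hB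
  rintro _ (rfl | rfl)
  · exact h3
  · exact h2.iso ((α_ _ _ _).symm ≪≫ isoA _ _ _)

omit [MonoidalPreadditive C] [BraidedCategory C] in
lemma good_s {n m : ℕ} (hn : n ≤ 4) (hm : m ≤ 4) : InAdd (Fam A B) (pw A n ⊗ pw B m) :=
  InAdd.of ⟨n, hn, m, hm, rfl⟩

include hA hB in
lemma good_a4 {m : ℕ} (hm : m ≤ 4) : InAdd (Fam A B) (pw A 5 ⊗ pw B m) := by
  refine good_a hA (good_s (by norm_num) hm) ?_
  rcases Nat.lt_or_ge m 4 with h | h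
  · exact good_s (by norm_num) (by omega)
  · obtain rfl : m = 4 := by omega
    exact good_b hB (good_s (by norm_num) (by norm_num)) (good_s (by norm_num) (by norm_num))

include hA hB in
lemma good_b4 {n : ℕ} (hn : n ≤ 4) : InAdd (Fam A B) (pw A n ⊗ pw B 5) := by
  refine good_b hB (good_s hn (by norm_num)) ?_
  rcases Nat.lt_or_ge n 4 with h | h
  · exact good_s (by omega) (by norm_num)
  · obtain rfl : n = 4 := by omega
    exact good_a4 hA hB (by norm_num)

include hA hB in
lemma fam_A {Z : C} (h : InAdd (Fam A B) Z) : InAdd (Fam A B) (Z ⊗ A) := by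
  refine InAdd.tensorRight _ ?_ h
  rintro _ ⟨i, hi, j, hj, rfl⟩
  refine InAdd.iso (X := pw A (i + 1) ⊗ pw B j) ?_ (isoA _ _ _)
  rcases Nat.lt_or_ge i 4 with h | h
  · exact good_s (by omega) hj
  · obtain rfl : i = 4 := by omega
    exact good_a4 hA hB hj

include hA hB in
lemma fam_B {Z : C} (h : InAdd (Fam A B) Z) : InAdd (Fam A B) (Z ⊗ B) := by
  refine InAdd.tensorRight _ ?_ h
  rintro _ ⟨i, hi, j, hj, rfl⟩
  refine InAdd.iso (X := pw A i ⊗ pw B (j + 1)) ?_ (α_ _ _ _)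
  rcases Nat.lt_or_ge j 4 with h | h
  · exact good_s hi (by omega)
  · obtain rfl : j = 4 := by omega
    exact good_b4 hA hB hi

omit [MonoidalPreadditive C] [BraidedCategory C] in
lemma pw_closed {T : C → Prop} {A : C} (hT : ∀ Z, InAdd T Z → InAdd T (Z ⊗ A)) (n : ℕ) :
    ∀ Z, InAdd T Z → InAdd T (Z ⊗ pw A n) := by
  induction n with
  | zero => exact fun Z h => h.iso (ρ_ Z)
  | succ n ih => exact fun Z h => (hT _ (ih Z h)).iso (α_ _ _ _).symm

include hA hB in
lemma fam_mul {X Z : C} (hX : InAdd (Fam A B) X) (h : InAdd (Fam A B) Z) :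
    InAdd (Fam A B) (Z ⊗ X) := by
  refine InAdd.tensorLeft _ ?_ hX
  rintro _ ⟨i, _, j, _, rfl⟩
  exact (pw_closed (fun Z h => fam_B hA hB h) j _
    (pw_closed (fun Z h => fam_A hA hB h) i Z h)).iso (α_ _ _ _).symm

end Pw

section Dec
variable {K : Type} [Field K] [CharP K 3] (ι : K) 

omit [CharP K 3] in
/-- decoding -/
def dec (z : ℕ) : K := ((z % 3 : ℕ) : K) + ((z / 3 % 3 : ℕ) : K) * ι

lemma dec_eq (a b : ℕ) (z : ℕ) (h1 : z % 3 = a % 3) (h2 : z / 3 % 3 = b % 3) :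
    dec ι z = (a : K) + (b : K) * ι := by
  rw [dec, h1, h2, ← CharP.cast_eq_mod, ← CharP.cast_eq_mod]

lemma ad_spec (a b : ℕ) : ad a b % 3 = (a % 3 + b % 3) % 3 ∧
    ad a b / 3 % 3 = (a / 3 % 3 + b / 3 % 3) % 3 := by
  have h : ∀ a < 9, ∀ b < 9, ad a b % 3 = (a % 3 + b % 3) % 3 ∧
    ad a b / 3 % 3 = (a / 3 % 3 + b / 3 % 3) % 3 := by decide +kernel
  have h2 := h (a % 9) (Nat.mod_lt _ (by norm_num)) (b % 9) (Nat.mod_lt _ (by norm_num))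
  have h3 : ad (a % 9) (b % 9) = ad a b := by simp [ad]
  rw [h3] at h2
  omega

lemma ml_spec (a b : ℕ) :
    ml a b % 3 = (a % 3 * (b % 3) + 2 * ((a / 3 % 3) * (b / 3 % 3))) % 3 ∧
    ml a b / 3 % 3 = (a % 3 * (b / 3 % 3) + a / 3 % 3 * (b % 3)) % 3 := by
  have h : ∀ a < 9, ∀ b < 9, 
    ml a b % 3 = (a % 3 * (b % 3) + 2 * ((a / 3 % 3) * (b / 3 % 3))) % 3 ∧
    ml a b / 3 % 3 = (a % 3 * (b / 3 % 3) + a / 3 % 3 * (b % 3)) % 3 := by decide +kernel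
  have h2 := h (a % 9) (Nat.mod_lt _ (by norm_num)) (b % 9) (Nat.mod_lt _ (by norm_num))
  have h3 : ml (a % 9) (b % 9) = ml a b := by simp [ml]
  have e : ∀ a, a % 9 % 3 = a % 3 ∧ a % 9 / 3 % 3 = a / 3 % 3 := by intro a; omega
  rwa [h3, (e a).1, (e a).2, (e b).1, (e b).2] at h2

lemma dec_ad (a b : ℕ) : dec ι (ad a b) = dec ι a + dec ι b := by
  obtain ⟨h1, h2⟩ := ad_spec a b
  rw [dec_eq ι _ _ _ h1 h2]
  simp only [dec]; push_cast; ring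

lemma three_zero : (3 : K) = 0 := by
  have := CharP.cast_eq_zero K 3
  exact_mod_cast this

variable (hι : ι * ι = -1)
include hι

lemma dec_ml (a b : ℕ) : dec ι (ml a b) = dec ι a * dec ι b := by
  obtain ⟨h1, h2⟩ := ml_spec a b
  rw [dec_eq ι _ _ _ h1 h2]
  simp only [dec]; push_cast
  linear_combination (-((a / 3 % 3 : ℕ) : K) * ((b / 3 % 3 : ℕ) : K)) * hι + (((a / 3 % 3 : ℕ) : K) * ((b / 3 % 3 : ℕ) : K)) * (three_zero (K := K))

lemma dec_lz (a b : ℕ) : dec ι (lz a b) = dec ι a * dec ι b := by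
  cases a with
  | zero => simp [lz, dec]
  | succ n => exact dec_ml ι hι (n + 1) b

omit hι in
lemma dec_gs (n : ℕ) (f : ℕ → ℕ) : dec ι (gs n f) = ∑ i : Fin n, dec ι (f i) := by
  induction n with
  | zero => simp [gs, dec]
  | succ n ih => rw [gs, dec_ad, ih, Fin.sum_univ_castSucc, add_comm]; rfl

omit [CharP K 3] hι in
lemma al_spec {n : ℕ} {f : ℕ → Bool} (h : al n f = true) : ∀ i : Fin n, f i = true := by
  induction n with
  | zero => exact fun i => i.elim0
  | succ n ih =>
    simp only [al, Bool.and_eq_true] at h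
    intro i
    induction i using Fin.lastCases with
    | last => exact h.1
    | cast i => exact ih h.2 i

omit [CharP K 3] hι in
/-- decoding a matrix -/
def dm (M N : ℕ) (P : ℕ → ℕ → ℕ) : Matrix (Fin M) (Fin N) K := Matrix.of fun i j => dec ι (P i j)

lemma okc_spec {N M : ℕ} {α α' P : ℕ → ℕ → ℕ} (h : okc N M α α' P = true) :
    dm ι M N P * dm ι N N α = dm ι M M α' * dm ι M N P := by
  ext i j
  have h1 := al_spec (al_spec h i) j
  have h2 := congrArg (dec ι) (Nat.eq_of_beq_eq_true h1)
  rw [dec_gs, dec_gs] at h2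
  simp only [Matrix.mul_apply, dm, Matrix.of_apply]
  simp only [dec_lz ι hι] at h2
  rw [h2]
  exact Finset.sum_congr rfl fun l _ => mul_comm _ _

omit hι in
omit [CharP K 3] in
/-- coded representations -/
noncomputable def Rp (N : ℕ) (α : Bool → ℕ → ℕ → ℕ) : FDRep K (FreeMonoid Bool) :=
  FDRep.of (V := Fin N → K) (FreeMonoid.lift fun c => Matrix.toLin' (dm ι N N (α c)))

omit [CharP K 3] hι in
lemma Rp_rho (N : ℕ) (α : Bool → ℕ → ℕ → ℕ) (c : Bool) (v : Fin N → K) :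
    (Rp ι N α).ρ (FreeMonoid.of c) v = (dm ι N N (α c)).mulVec v := by
  change (FreeMonoid.lift (fun c => Matrix.toLin' (dm ι N N (α c))) (FreeMonoid.of c)) v = _
  rw [FreeMonoid.lift_eval_of]
  rfl

omit [CharP K 3] hι in
lemma free_comm {V W : FDRep K (FreeMonoid Bool)} (f : V →ₗ[K] W)
    (h : ∀ c v, f (V.ρ (FreeMonoid.of c) v) = W.ρ (FreeMonoid.of c) (f v)) :
    ∀ g v, f (V.ρ g v) = W.ρ g (f v) := by
  intro g
  induction g using FreeMonoid.inductionOn with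
  | one => intro v; simp
  | of c => exact h c
  | mul a b ha hb =>
    intro v
    rw [map_mul, map_mul, Module.End.mul_apply, Module.End.mul_apply, ha, hb]

/-- coded morphisms -/
lemma exists_hom {N M : ℕ} {α α' : Bool → ℕ → ℕ → ℕ} (P : ℕ → ℕ → ℕ)
    (h : ∀ c, okc N M (α c) (α' c) P = true) :
    ∃ f : Rp ι N α ⟶ Rp ι M α', ∀ v : Fin N → K, lin f v = (dm ι M N P).mulVec v := by
  refine ⟨mkHom (V := Rp ι N α) (W := Rp ι M α') (Matrix.toLin' (dm ι M N P))
    (free_comm (V := Rp ι N α) (W := Rp ι M α') _ ?_), fun v => rfl⟩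
  intro c v
  have h1 := congrArg (fun x : Fin N → K => (dm ι M N P).mulVec x) (Rp_rho ι N α c v)
  have := Rp_rho ι M α' c ((dm ι M N P).mulVec v)
  have key : ∀ v : Fin N → K, (dm ι M N P).mulVec ((dm ι N N (α c)).mulVec v) =
      (dm ι M M (α' c)).mulVec ((dm ι M N P).mulVec v) := by
    intro v
    rw [Matrix.mulVec_mulVec, Matrix.mulVec_mulVec, okc_spec ι hι (h c)]
  exact Eq.trans h1 (Eq.trans (key v) this.symm)

omit hι [CharP K 3] in
lemma iso_of_basis {N : ℕ} (V : FDRep K (FreeMonoid Bool)) (b : Module.Basis (Fin N) K V)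
    (α : Bool → ℕ → ℕ → ℕ)
    (h : ∀ c j, V.ρ (FreeMonoid.of c) (b j) = ∑ i : Fin N, dec ι (α c i j) • b i) :
    Nonempty (V ≅ Rp ι N α) := by
  have key : ∀ c v, b.equivFun (V.ρ (FreeMonoid.of c) v) =
      (dm ι N N (α c)).mulVec (b.equivFun v) := by
    intro c
    have : b.equivFun.toLinearMap ∘ₗ (V.ρ (FreeMonoid.of c)) =
        (Matrix.toLin' (dm ι N N (α c))) ∘ₗ b.equivFun.toLinearMap := by
      refine b.ext fun j => ?_
      rw [LinearMap.comp_apply, LinearMap.comp_apply, h, LinearEquiv.coe_coe, map_sum]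
      simp only [map_smul]
      ext i
      simp [Matrix.toLin'_apply, Matrix.mulVec, dotProduct, dm, Finset.sum_apply, Finsupp.single_apply]
    exact fun v => LinearMap.congr_fun this v
  have key2 : ∀ c v, b.equivFun.symm ((dm ι N N (α c)).mulVec v) =
      V.ρ (FreeMonoid.of c) (b.equivFun.symm v) := by
    intro c v
    rw [LinearEquiv.symm_apply_eq, key, LinearEquiv.apply_symm_apply]
  refine ⟨⟨mkHom (W := Rp ι N α) b.equivFun.toLinearMap
    (free_comm (W := Rp ι N α) _ fun c v => ?_),
    mkHom (V := Rp ι N α) b.equivFun.symm.toLinearMap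
    (free_comm (V := Rp ι N α) _ fun c v => ?_), ?_, ?_⟩⟩
  · exact (key c v).trans (Rp_rho ι N α c _).symm
  · have h1 := congrArg (fun x : Fin N → K => b.equivFun.symm x) (Rp_rho ι N α c v)
    exact h1.trans (key2 c v)
  · apply lin_inj; ext v; exact b.equivFun.symm_apply_apply v
  · apply lin_inj; ext v : 1; exact b.equivFun.apply_symm_apply v

omit hι [CharP K 3] in
lemma Rp_basis (N : ℕ) (α : Bool → ℕ → ℕ → ℕ) : 
    ∃ b : Module.Basis (Fin N) K (Rp ι N α), ∀ c j, (Rp ι N α).ρ (FreeMonoid.of c) (b j) =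
      ∑ i : Fin N, dec ι (α c i j) • b i := by
  let b : Module.Basis (Fin N) K (Fin N → K) := Pi.basisFun K (Fin N)
  refine ⟨b, fun c j => ?_⟩
  refine (Rp_rho ι N α c _).trans ?_
  change (dm ι N N (α c)).mulVec (b j) = ∑ i : Fin N, dec ι (α c i j) • b i
  ext i
  have hb : ∀ p q, b p q = if q = p then 1 else 0 := by
    intro p q
    rw [show b p = Pi.single p 1 from Pi.basisFun_apply K (Fin N) p, Pi.single_apply]
  simp [Matrix.mulVec, dotProduct, dm, Finset.sum_apply, hb]

lemma iso_tensor {X Y : FDRep K (FreeMonoid Bool)} {M N : ℕ} {α β : Bool → ℕ → ℕ → ℕ}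
    (hX : Nonempty (X ≅ Rp ι M α)) (hY : Nonempty (Y ≅ Rp ι N β)) :
    Nonempty (X ⊗ Y ≅ Rp ι (M * N) (fun c => kr N (α c) (β c))) := by
  obtain ⟨e⟩ := hX
  obtain ⟨e'⟩ := hY
  obtain ⟨b, hb⟩ := Rp_basis ι M α
  obtain ⟨b', hb'⟩ := Rp_basis ι N β
  obtain ⟨e2⟩ := iso_of_basis ι (Rp ι M α ⊗ Rp ι N β)
    ((b.tensorProduct b').reindex finProdFinEquiv) (fun c => kr N (α c) (β c)) (by
      intro c j
      obtain ⟨⟨p, q⟩, rfl⟩ := finProdFinEquiv.surjective j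
      rw [rho_tensor, ← Equiv.sum_comp finProdFinEquiv, Fintype.sum_prod_type]
      simp only [Module.Basis.reindex_apply, Equiv.symm_apply_apply]
      rw [Module.Basis.tensorProduct_apply, TensorProduct.map_tmul, hb, hb', TensorProduct.sum_tmul]
      refine Finset.sum_congr rfl fun r _ => ?_
      rw [TensorProduct.tmul_sum]
      refine Finset.sum_congr rfl fun s _ => ?_
      rw [Module.Basis.tensorProduct_apply, TensorProduct.smul_tmul_smul]
      congr 1
      have hN : 0 < N := s.pos
      have e1 : ∀ (x : Fin M) (y : Fin N), ((finProdFinEquiv (x, y) : Fin (M * N)) : ℕ) / N = x ∧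
          ((finProdFinEquiv (x, y) : Fin (M * N)) : ℕ) % N = y := by
        intro x y
        simp only [finProdFinEquiv_apply_val]
        constructor
        · rw [Nat.add_mul_div_left _ _ hN, Nat.div_eq_of_lt y.2, zero_add]
        · rw [Nat.add_mul_mod_self_left, Nat.mod_eq_of_lt y.2]
      rw [kr, dec_lz ι hι, (e1 _ _).1, (e1 _ _).1, (e1 _ _).2, (e1 _ _).2, mul_comm])
  exact ⟨(e ⊗ᵢ e') ≪≫ e2⟩

end Dec
end AlgMod
namespace AlgMod
section KeyMat
/-- fivefold Kronecker power -/
def w5 (s : ℕ) : ℕ → ℕ → ℕ := kr 2 (kr 2 (kr 2 (kr 2 (un s) (un s)) (un s)) (un s)) (un s)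
/-- threefold Kronecker product -/
def w3 (s t : ℕ) : ℕ → ℕ → ℕ := kr 2 (kr 2 (un s) (un s)) (un t)
/-- digit sum -/
def pc (p : ℕ) : ℕ := p % 2 + p / 2 % 2 + p / 4 % 2 + p / 8 % 2 + p / 16 % 2
/-- weight -/
def pt (t : ℕ) : ℕ := t / 4 % 2 + t / 2 % 2 + 3 * (t % 2)
/-- projection matrix -/
def Pm (t q : ℕ) : ℕ := cond (Nat.beq (pc q) (pt t)) (cond (Nat.beq (pt t % 3) 1) 2 1) 0
/-- inclusion matrix -/
def Qm (p t : ℕ) : ℕ :=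
  cond (Nat.beq (pc p) (pt t)) (cond (Nat.beq (pt t) 1) 2 (cond (Nat.beq (pt t) 4) 2 1)) 0
/-- rotation of digits -/
def rc (p : ℕ) : ℕ := p / 2 + 16 * (p % 2)
/-- transposition of the lowest two digits -/
def rt (p : ℕ) : ℕ := p / 4 * 4 + 2 * (p % 2) + p / 2 % 2
/-- conjugated transposition -/
def rr (r : ℕ) (p : ℕ) : ℕ := rc^[5 - r] (rt (rc^[r] p))
/-- multiplier -/
def rm (p : ℕ) : ℕ := rr 2 (rr 1 (rr 3 p))
/-- permutation matrix -/
def pm (π : ℕ → ℕ) (p q : ℕ) : ℕ := cond (Nat.beq (π p) q) 1 0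
/-- cap -/
def Cm (l q : ℕ) : ℕ := cond (Nat.beq q (4 * l + 1)) 1 (cond (Nat.beq q (4 * l + 2)) 2 0)
/-- cup -/
def Dm (p l : ℕ) : ℕ := Cm l p
/-- product of coded matrices -/
def mm (n : ℕ) (A B : ℕ → ℕ → ℕ) (i j : ℕ) : ℕ := gs n (fun l => lz (A i l) (B l j))
/-- coded equality -/
def eqc (M N : ℕ) (A B : ℕ → ℕ → ℕ) : Bool := al M fun i => al N fun j => Nat.beq (A i j) (B i j)

set_option maxRecDepth 100000
lemma chk1 : ∀ s ∈ [1, 3, 6], okc 32 8 (w5 s) (w3 s s) Cm = true := by decide +kernel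
lemma chk2 : ∀ s ∈ [1, 3, 6], okc 8 32 (w3 s s) (w5 s) Dm = true := by decide +kernel
lemma chk3 : ∀ s ∈ [(1, 1), (3, 6), (6, 3)], okc 32 8 (w5 s.1) (w3 s.1 s.2) Pm = true := by
  decide +kernel
lemma chk4 : ∀ s ∈ [(1, 1), (3, 6), (6, 3)], okc 8 32 (w3 s.1 s.2) (w5 s.1) Qm = true := by
  decide +kernel
lemma chk5 : ∀ s ∈ [1, 3, 6], okc 32 32 (w5 s) (w5 s) (pm rc) = true := by decide +kernel
lemma chk6 : eqc 32 32 (mm 8 Dm Cm) (fun p q => ad (pm id p q) (ml 2 (pm rt p q))) = true := by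
  decide +kernel
lemma chk7 : eqc 32 32 (mm 8 Qm Pm)
    (fun p q => ml 2 (gs 5 fun i => gs 4 fun j => pm (rc^[i] ∘ rm^[j]) p q)) = true := by
  decide +kernel
lemma chk8 : ∀ p < 32, rr 3 (rr 2 (rr 1 (rr 0 p))) = rc p := by decide +kernel
lemma chk9 : ∀ p < 32, rc p < 32 ∧ rt p < 32 ∧ rc (rc (rc (rc (rc p)))) = p := by decide +kernel
end KeyMat
end AlgMod
namespace AlgMod
section Key
variable {K : Type} [Field K] [CharP K 3] (ι : K)

/-- a morphism given by a matrix -/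
def MH {N M : ℕ} {α α' : Bool → ℕ → ℕ → ℕ} (f : Rp ι N α ⟶ Rp ι M α')
    (P : Matrix (Fin M) (Fin N) K) : Prop := ∀ v : Fin N → K, lin f v = P.mulVec v

/-- matrices of morphisms in the ideal -/
def TM (S : FDRep K (FreeMonoid Bool) → Prop) {N M : ℕ} (α α' : Bool → ℕ → ℕ → ℕ)
    (P : Matrix (Fin M) (Fin N) K) : Prop :=
  ∃ f : Rp ι N α ⟶ Rp ι M α', f ∈ Thru S _ _ ∧ MH ι f P

variable {ι} {S : FDRep K (FreeMonoid Bool) → Prop} {N M L : ℕ} {α β γ δ : Bool → ℕ → ℕ → ℕ}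

omit [CharP K 3] in
lemma MH.comp {f : Rp ι N α ⟶ Rp ι M β} {g : Rp ι M β ⟶ Rp ι L γ} {P : Matrix (Fin M) (Fin N) K}
    {Q : Matrix (Fin L) (Fin M) K} (hf : MH ι f P) (hg : MH ι g Q) : MH ι (f ≫ g) (Q * P) := by
  intro v
  have h1 := congrArg (fun x : Fin M → K => (lin g : (Fin M → K) →ₗ[K] (Fin L → K)) x) (hf v)
  refine Eq.trans h1 ((hg _).trans ?_)
  exact Matrix.mulVec_mulVec _ _ _

omit [CharP K 3] in
lemma MH.unique {f g : Rp ι N α ⟶ Rp ι M β} {P : Matrix (Fin M) (Fin N) K}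
    (hf : MH ι f P) (hg : MH ι g P) : f = g := by
  apply lin_inj; ext v : 1; exact (hf v).trans (hg v).symm

omit [CharP K 3] in
lemma TM.add {P Q : Matrix (Fin M) (Fin N) K} (h : TM ι S α β P) (h' : TM ι S α β Q) :
    TM ι S α β (P + Q) := by
  obtain ⟨f, hf, hP⟩ := h
  obtain ⟨g, hg, hQ⟩ := h'
  refine ⟨f + g, add_mem hf hg, fun v => ?_⟩
  have : P.mulVec v + Q.mulVec v = (P + Q).mulVec v := (Matrix.add_mulVec _ _ _).symm
  exact Eq.trans (congrArg₂ (fun a b : Fin M → K => a + b) (hP v) (hQ v)) this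

omit [CharP K 3] in
lemma TM.zero : TM ι S α β (0 : Matrix (Fin M) (Fin N) K) := by
  refine ⟨0, zero_mem _, fun v => ?_⟩
  exact (Matrix.zero_mulVec v).symm

omit [CharP K 3] in
lemma TM.mul {P : Matrix (Fin M) (Fin N) K} (h : TM ι S α β P) {L' : ℕ}
    {f : Rp ι L γ ⟶ Rp ι N α} {g : Rp ι M β ⟶ Rp ι L' δ} {A : Matrix (Fin N) (Fin L) K}
    {B : Matrix (Fin L') (Fin M) K} (hf : MH ι f A) (hg : MH ι g B) :
    TM ι S γ δ (B * P * A) := by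
  obtain ⟨h, hh, hP⟩ := h
  exact ⟨f ≫ h ≫ g, Thru.comp hh f g, by rw [Matrix.mul_assoc, ← Matrix.mul_assoc]; exact hf.comp (hP.comp hg)⟩

omit [CharP K 3] in
lemma MH.one : MH ι (𝟙 (Rp ι N α)) (1 : Matrix (Fin N) (Fin N) K) := 
  fun v => (Matrix.one_mulVec v).symm

omit [CharP K 3] in
lemma TM.nsmul {P : Matrix (Fin M) (Fin N) K} (h : TM ι S α β P) (n : ℕ) : TM ι S α β (n • P) := by
  induction n with
  | zero => rw [zero_smul]; exact TM.zero
  | succ n ih => rw [succ_nsmul]; exact ih.add h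

lemma TM.neg {P : Matrix (Fin M) (Fin N) K} (h : TM ι S α β P) : TM ι S α β (-P) := by
  have := h.nsmul 2
  have e : (2 : ℕ) • P = -P := by
    have := three_zero (K := K)
    rw [two_nsmul, eq_neg_iff_add_eq_zero]
    ext i j
    simp only [Matrix.add_apply, Matrix.zero_apply]
    linear_combination P i j * this
  rwa [e] at this

omit [CharP K 3] in
lemma TM.sum {κ : Type} (s : Finset κ) {P : κ → Matrix (Fin M) (Fin N) K}
    (h : ∀ i ∈ s, TM ι S α β (P i)) : TM ι S α β (∑ i ∈ s, P i) := by
  classical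
  induction s using Finset.induction_on with
  | empty => rw [Finset.sum_empty]; exact TM.zero
  | insert a s ha ih =>
    rw [Finset.sum_insert ha]
    exact (h a (by simp)).add (ih fun i hi => h i (by simp [hi]))

omit [CharP K 3] in
lemma TM.inAdd (h : TM ι S α α (1 : Matrix (Fin N) (Fin N) K)) : InAdd S (Rp ι N α) := by
  obtain ⟨f, hf, hP⟩ := h
  rw [hP.unique MH.one] at hf
  exact hf

omit [CharP K 3] in
lemma eqc_spec {A B : ℕ → ℕ → ℕ} (h : eqc M N A B = true) : dm ι M N A = dm ι M N B := by
  ext i j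
  exact congrArg (dec ι) (Nat.eq_of_beq_eq_true (al_spec (al_spec h i) j))

omit [CharP K 3] in
lemma dm_pm (π : ℕ → ℕ) (p q : Fin N) : dm ι N N (pm π) p q = if π p = q then 1 else 0 := by
  simp only [dm, Matrix.of_apply, pm]
  by_cases h : π p = q
  · rw [h, Nat.beq_refl]; simp [dec]
  · rw [if_neg h]
    have : Nat.beq (π p) q = false := by
      rw [Bool.eq_false_iff]; exact fun h' => h (Nat.eq_of_beq_eq_true h')
    rw [this]; simp [dec]

omit [CharP K 3] in
lemma dm_pm_mul (π π' : ℕ → ℕ) (h : ∀ p < N, π p < N) :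
    dm ι N N (pm π) * dm ι N N (pm π') = dm ι N N (pm (π' ∘ π)) := by
  ext p q
  rw [Matrix.mul_apply, dm_pm, Finset.sum_eq_single ⟨π p, h p p.2⟩]
  · rw [dm_pm, dm_pm]; simp
  · intro b _ hb
    rw [dm_pm, if_neg, zero_mul]
    intro h'; exact hb (Fin.ext h'.symm)
  · simp

omit [CharP K 3] in
lemma dm_pm_congr {π π' : ℕ → ℕ} (h : ∀ p < N, π p = π' p) :
    dm ι N N (pm π) = dm ι N N (pm π') := by
  ext p q; rw [dm_pm, dm_pm, h p p.2]

omit [CharP K 3] in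
lemma dm_pm_id : dm ι N N (pm id) = 1 := by
  ext p q; rw [dm_pm, Matrix.one_apply]; simp [Fin.ext_iff]

variable (hι : ι * ι = -1)

include hι in
lemma dm_mm (A B : ℕ → ℕ → ℕ) : dm ι M N (mm L A B) = dm ι M L A * dm ι L N B := by
  ext i j
  simp only [dm, Matrix.of_apply, Matrix.mul_apply, mm, dec_gs, dec_lz ι hι]

/-- permutations congruent to the identity -/
def Cg (ι : K) (S : FDRep K (FreeMonoid Bool) → Prop) (α : Bool → ℕ → ℕ → ℕ) (π : ℕ → ℕ) : Prop :=
  (∀ p < 32, π p < 32) ∧ TM ι S α α (1 - dm ι 32 32 (pm π))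

lemma Cg.comp {π π' : ℕ → ℕ} (h : Cg ι S α π) (h' : Cg ι S α π') : Cg ι S α (π' ∘ π) := by
  refine ⟨fun p hp => h'.1 _ (h.1 p hp), ?_⟩
  rw [← dm_pm_mul _ _ h.1]
  obtain ⟨f, hf, hP⟩ := h.2
  have := (h.2.add h'.2).add (h'.2.mul MH.one hP).neg
  convert this using 1
  noncomm_ring

omit [CharP K 3] in
lemma Cg.congr {π π' : ℕ → ℕ} (h : Cg ι S α π) (e : ∀ p < 32, π p = π' p) : Cg ι S α π' :=
  ⟨fun p hp => by rw [← e p hp]; exact h.1 p hp, by rw [← dm_pm_congr e]; exact h.2⟩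

omit [CharP K 3] in
lemma Cg.id : Cg ι S α id := ⟨fun p hp => hp, by rw [dm_pm_id, sub_self]; exact TM.zero⟩

lemma Cg.iter {π : ℕ → ℕ} (h : Cg ι S α π) (n : ℕ) : Cg ι S α (π^[n]) := by
  induction n with
  | zero => exact Cg.id
  | succ n ih => exact h.comp ih

omit [CharP K 3] in
lemma rc_iter_lt (n : ℕ) : ∀ p < 32, rc^[n] p < 32 := by
  induction n with
  | zero => exact fun p h => h
  | succ n ih => exact fun p h => ih _ (chk9 p h).1

omit [CharP K 3] in
lemma rc_hom_iter {f : Rp ι 32 α ⟶ Rp ι 32 α} (hf : MH ι f (dm ι 32 32 (pm rc))) (n : ℕ) :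
    ∃ g : Rp ι 32 α ⟶ Rp ι 32 α, MH ι g (dm ι 32 32 (pm (rc^[n]))) := by
  induction n with
  | zero => exact ⟨_, by rw [Function.iterate_zero, dm_pm_id]; exact MH.one⟩
  | succ n ih =>
    obtain ⟨g, hg⟩ := ih
    refine ⟨g ≫ f, ?_⟩
    rw [Function.iterate_succ, ← dm_pm_mul _ _ fun p hp => (chk9 p hp).1]
    exact hg.comp hf

omit [CharP K 3] in
lemma Cg.conj {π : ℕ → ℕ} (h : Cg ι S α π) {f : Rp ι 32 α ⟶ Rp ι 32 α}
    (hf : MH ι f (dm ι 32 32 (pm rc))) (r : ℕ) (hr : r ≤ 5) :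
    Cg ι S α (fun p => rc^[5 - r] (π (rc^[r] p))) := by
  refine ⟨fun p hp => rc_iter_lt _ _ (h.1 _ (rc_iter_lt _ _ hp)), ?_⟩
  obtain ⟨g, hg⟩ := rc_hom_iter hf r
  obtain ⟨g', hg'⟩ := rc_hom_iter hf (5 - r)
  have := h.2.mul hg' hg
  have e : dm ι 32 32 (pm (rc^[r])) * dm ι 32 32 (pm (rc^[5 - r])) = 1 := by
    rw [dm_pm_mul _ _ (rc_iter_lt r), ← dm_pm_id, ← Function.iterate_add, Nat.sub_add_cancel hr]
    exact dm_pm_congr fun p hp => (chk9 p hp).2.2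
  rw [Matrix.mul_sub, Matrix.sub_mul, Matrix.mul_one, e, dm_pm_mul _ _ (rc_iter_lt r),
    dm_pm_mul (π ∘ rc^[r]) _ (fun p hp => h.1 _ (rc_iter_lt _ _ hp))] at this
  exact this

include hι in
lemma key_core {s t : ℕ} (hst : (s, t) ∈ [(3, 6), (6, 3)])
    (h3 : InAdd S (Rp ι 8 (fun c => w3 (cond c s 1) (cond c s 1))))
    (h2 : InAdd S (Rp ι 8 (fun c => w3 (cond c s 1) (cond c t 1)))) :
    InAdd S (Rp ι 32 (fun c => w5 (cond c s 1))) := by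
  have hs : ∀ c : Bool, cond c s 1 ∈ [1, 3, 6] := by
    simp only [List.mem_cons, Prod.mk.injEq, List.not_mem_nil, or_false] at hst
    rcases hst with ⟨rfl, rfl⟩ | ⟨rfl, rfl⟩ <;> decide
  have hs2 : ∀ c : Bool, (cond c s 1, cond c t 1) ∈ [(1, 1), (3, 6), (6, 3)] := by
    simp only [List.mem_cons, Prod.mk.injEq, List.not_mem_nil, or_false] at hst
    rcases hst with ⟨rfl, rfl⟩ | ⟨rfl, rfl⟩ <;> decide
  obtain ⟨fC, hC⟩ := exists_hom ι hι Cm (fun c => chk1 _ (hs c))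
  obtain ⟨fD, hD⟩ := exists_hom ι hι Dm (fun c => chk2 _ (hs c))
  obtain ⟨fP, hP⟩ := exists_hom ι hι Pm (fun c => chk3 _ (hs2 c))
  obtain ⟨fQ, hQ⟩ := exists_hom ι hι Qm (fun c => chk4 _ (hs2 c))
  obtain ⟨fc, hc⟩ := exists_hom ι hι (pm rc) (fun c => chk5 _ (hs c))
  have two : dec ι 2 = -1 := by
    have := three_zero (K := K)
    simp [dec]; linear_combination this
  have c0 : Cg ι S (fun c => w5 (cond c s 1)) rt := by
    refine ⟨fun p hp => (chk9 p hp).2.1, fC ≫ fD, h3.thru _ _, ?_⟩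
    have e := eqc_spec (ι := ι) chk6
    rw [dm_mm hι] at e
    have e2 : dm ι 32 32 (fun p q => ad (pm id p q) (ml 2 (pm rt p q))) = 1 - dm ι 32 32 (pm rt) := by
      rw [← dm_pm_id]
      ext i j
      simp only [dm, Matrix.of_apply, dec_ad, dec_ml ι hι, Matrix.sub_apply, two]
      ring
    rw [← e2, ← e]
    exact MH.comp hC hD
  have cr : ∀ r ≤ 5, Cg ι S (fun c => w5 (cond c s 1)) (rr r) := fun r hr => c0.conj hc r hr
  have c1 : Cg ι S (fun c => w5 (cond c s 1)) rc :=
    ((((cr 0 (by norm_num)).comp (cr 1 (by norm_num))).comp (cr 2 (by norm_num))).comp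
      (cr 3 (by norm_num))).congr chk8
  have c2 : Cg ι S (fun c => w5 (cond c s 1)) rm :=
    ((cr 3 (by norm_num)).comp (cr 1 (by norm_num))).comp (cr 2 (by norm_num))
  have hE : TM ι S (fun c => w5 (cond c s 1)) (fun c => w5 (cond c s 1))
      (dm ι 32 8 Qm * dm ι 8 32 Pm) := ⟨fP ≫ fQ, h2.thru _ _, MH.comp hP hQ⟩
  have e := eqc_spec (ι := ι) chk7
  rw [dm_mm hι] at e
  rw [e] at hE
  have hsum : TM ι S (fun c => w5 (cond c s 1)) (fun c => w5 (cond c s 1))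
      (∑ i : Fin 5, ∑ j : Fin 4, (1 - dm ι 32 32 (pm (rc^[i] ∘ rm^[j])))) :=
    TM.sum _ fun i _ => TM.sum _ fun j _ => ((c2.iter j).comp (c1.iter i)).2
  apply TM.inAdd
  convert hE.add hsum.neg using 1
  ext p q
  simp only [Finset.sum_sub_distrib, Matrix.add_apply, Matrix.neg_apply, Matrix.sub_apply,
    Finset.sum_const, Finset.card_univ, Fintype.card_fin, Matrix.smul_apply, Matrix.sum_apply]
  simp only [dm, Matrix.of_apply, dec_ml ι hι, dec_gs, two, nsmul_eq_mul]
  push_cast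
  linear_combination (7 * (1 : Matrix (Fin 32) (Fin 32) K) p q) * three_zero (K := K)

/-- the basic two-dimensional module -/
noncomputable def Wm (ι : K) (s : ℕ) : FDRep K (FreeMonoid Bool) :=
  Rp ι 2 (fun c => un (cond c s 1))

omit [CharP K 3] in
lemma iso_pw1 (ι : K) (s : ℕ) : Nonempty (pw (Wm ι s) 1 ≅ Rp ι 2 (fun c => un (cond c s 1))) :=
  ⟨λ_ _⟩

include hι in
lemma iso_pw2 (s : ℕ) : Nonempty (pw (Wm ι s) 2 ≅
    Rp ι 4 (fun c => kr 2 (un (cond c s 1)) (un (cond c s 1)))) :=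
  iso_tensor ι hι (iso_pw1 ι s) ⟨Iso.refl (Wm ι s)⟩

include hι in
lemma key_rel {s t : ℕ} (hst : (s, t) ∈ [(3, 6), (6, 3)]) : KeyRel (Wm ι s) (Wm ι t) := by
  have i3 : Nonempty (pw (Wm ι s) 3 ≅ Rp ι 8 (fun c => w3 (cond c s 1) (cond c s 1))) :=
    iso_tensor ι hι (iso_pw2 hι s) ⟨Iso.refl (Wm ι s)⟩
  have i3' : Nonempty (pw (Wm ι s) 2 ⊗ Wm ι t ≅ Rp ι 8 (fun c => w3 (cond c s 1) (cond c t 1))) :=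
    iso_tensor ι hι (iso_pw2 hι s) ⟨Iso.refl (Wm ι t)⟩
  have i5 : Nonempty (pw (Wm ι s) 5 ≅ Rp ι 32 (fun c => w5 (cond c s 1))) :=
    iso_tensor ι hι (iso_tensor ι hι i3 ⟨Iso.refl (Wm ι s)⟩) ⟨Iso.refl (Wm ι s)⟩
  obtain ⟨e3⟩ := i3
  obtain ⟨e3'⟩ := i3'
  obtain ⟨e5⟩ := i5
  refine InAdd.iso (key_core hι hst ?_ ?_) e5
  · exact InAdd.iso (InAdd.of (Or.inl rfl)) e3.symm
  · exact InAdd.iso (InAdd.of (Or.inr rfl)) e3'.symm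
end Key
end AlgMod
namespace AlgMod
/-- table lookup -/
def lk (X n i j : ℕ) : ℕ := (X >>> (4 * (n * i + j))) % 16
/-- generator matrices of the four types -/
def ty1 (_ : Bool) : ℕ → ℕ → ℕ := lk 1 1
/-- dimension four -/
def ty4 (c : Bool) : ℕ → ℕ → ℕ := lk (cond c 1224980202452418561 1157426203746959361) 4
/-- dimension six -/
def ty6 (c : Bool) : ℕ → ℕ → ℕ := lk (cond c 1394519680457221673326810800558960877240321
  1399241097991478249318246734612924867805185) 6
/-- dimension nine -/
def ty9 (c : Bool) : ℕ → ℕ → ℕ := lk (cond c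
  2269486225668031048242702166790065830133074799166481881506740570727407851461194610560002869428225
  2136508517132794854009731440662264758931581995888831009309900946165149122661633732818445159890945)
  9

/-- a representation has a basis with given matrices -/
def HasB {k : Type} [Field k] (V : FDRep k (FreeMonoid Bool)) (d : ℕ) (α : Bool → ℕ → ℕ → ℕ) :
    Prop := ∃ b : Module.Basis (Fin d) k V, ∀ c j,
      V.ρ (FreeMonoid.of c) (b j) = ∑ i : Fin d, ((α c i j : ℕ) : k) • b i

/-- first factor, second factor, mixed products -/
def rp1 (c : Bool) := kr 2 (un (cond c 3 1)) (un (cond c 3 1))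
/-- second -/
def rp2 (c : Bool) := kr 2 (un (cond c 6 1)) (un (cond c 6 1))
/-- mixed -/
def rp3 (c : Bool) := kr 2 (un (cond c 3 1)) (un (cond c 6 1))
/-- mixed -/
def rp4 (c : Bool) := kr 4 (rp1 c) (rp2 c)

/-- certificate -/
def P1m := lk 1396 1
/-- certificate -/
def Q1m := lk 2112 4
/-- certificate -/
def P4m := lk 566386030219351 4
/-- certificate -/
def Q4m := lk 2842074143708422144 4
/-- certificate -/
def P9m := lk 17995656254515991672880509124754069670487249520831840746269279658160829346800986645315006668847707683194273518914013966496475860735365103726783147606692576105928005 9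
/-- certificate -/
def Q9m := lk 17410505078744877353630177059664497580765738587935225553970477251559803443012985782526195547652842813210452309248140349296958694016986278843215257949676307825601264884908032 16
/-- certificate -/
def P6a := lk 547802884486560164103200 6
/-- certificate -/
def Q6a := lk 27031753499881486074825961472 4
/-- certificate -/
def P6b := lk 103893674911894425772369 6
/-- certificate -/
def Q6b := lk 21452398473582687357241417728 4

lemma ck1 : (∀ c, okc 1 4 (ty1 c) (rp1 c) P1m = true) ∧ (∀ c, okc 4 1 (rp1 c) (ty1 c) Q1m = true) ∧
  eqc 1 1 (mm 4 Q1m P1m) (pm id) = true := by decide +kernel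
lemma ck4 : (∀ c, okc 4 4 (ty4 c) (rp3 c) P4m = true) ∧ (∀ c, okc 4 4 (rp3 c) (ty4 c) Q4m = true) ∧
  eqc 4 4 (mm 4 Q4m P4m) (pm id) = true := by decide +kernel
lemma ck9 : (∀ c, okc 9 16 (ty9 c) (rp4 c) P9m = true) ∧
  (∀ c, okc 16 9 (rp4 c) (ty9 c) Q9m = true) ∧
  eqc 9 9 (mm 16 Q9m P9m) (pm id) = true := by decide +kernel
lemma ck6 : (∀ c, okc 6 4 (ty6 c) (rp1 c) P6a = true) ∧ (∀ c, okc 4 6 (rp1 c) (ty6 c) Q6a = true) ∧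
  (∀ c, okc 6 4 (ty6 c) (rp2 c) P6b = true) ∧ (∀ c, okc 4 6 (rp2 c) (ty6 c) Q6b = true) ∧
  eqc 6 6 (fun i j => ad (mm 4 Q6a P6a i j) (mm 4 Q6b P6b i j)) (pm id) = true := by decide +kernel
lemma ckb : (∀ c, ∀ i < 1, ∀ j < 1, ty1 c i j < 3) ∧ (∀ c, ∀ i < 4, ∀ j < 4, ty4 c i j < 3) ∧
  (∀ c, ∀ i < 6, ∀ j < 6, ty6 c i j < 3) ∧ (∀ c, ∀ i < 9, ∀ j < 9, ty9 c i j < 3) := by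
  decide +kernel

section
variable {k K : Type} [Field k] [Field K] [Algebra k K] [CharP K 3] {ι : K}
  (hι : ι * ι = -1)

omit [CharP K 3] in
lemma dec_small (n : ℕ) (h : n < 3) : dec ι n = algebraMap k K (n : k) := by
  rw [dec, Nat.mod_eq_of_lt h, Nat.div_eq_of_lt h]
  simp

omit [CharP K 3] in
lemma bc_iso {V : FDRep k (FreeMonoid Bool)} {d : ℕ} {α : Bool → ℕ → ℕ → ℕ} (h : HasB V d α)
    (hα : ∀ c, ∀ i < d, ∀ j < d, α c i j < 3) : Nonempty (bc K V ≅ Rp ι d α) := by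
  obtain ⟨b, hb⟩ := h
  refine iso_of_basis ι (bc K V) (b.baseChange K) α fun c j => ?_
  have key : (V.ρ (FreeMonoid.of c)).baseChange K (b.baseChange K j) =
      ∑ i : Fin d, dec ι (α c i j) • (b.baseChange K) i := by
    simp only [Module.Basis.baseChange_apply]
    rw [LinearMap.baseChange_tmul, hb, TensorProduct.tmul_sum]
    refine Finset.sum_congr rfl fun i _ => ?_
    rw [dec_small (k := k) _ (hα c i i.2 j j.2), algebraMap_smul, TensorProduct.tmul_smul]
  exact key

include hι in
lemma cert1 {N d : ℕ} {α β : Bool → ℕ → ℕ → ℕ} {P Q : ℕ → ℕ → ℕ} {S} (hS : InAdd S (Rp ι N β))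
    (h : (∀ c, okc d N (α c) (β c) P = true) ∧ (∀ c, okc N d (β c) (α c) Q = true) ∧
    eqc d d (mm N Q P) (pm id) = true) : InAdd S (Rp ι d α) := by
  obtain ⟨f, hf⟩ := exists_hom ι hι P h.1
  obtain ⟨g, hg⟩ := exists_hom ι hι Q h.2.1
  have e := eqc_spec (ι := ι) h.2.2
  rw [dm_mm hι, dm_pm_id] at e
  have h3 : MH ι (f ≫ g) _ := MH.comp hf hg
  rw [e] at h3
  exact hS.retract f g (h3.unique MH.one)

include hι in
lemma types_inAdd {V : FDRep k (FreeMonoid Bool)}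
    (h : HasB V 1 ty1 ∨ HasB V 4 ty4 ∨ HasB V 6 ty6 ∨ HasB V 9 ty9) :
    InAdd (Fam (Wm ι 3) (Wm ι 6)) (bc K V) := by
  obtain ⟨i1⟩ := iso_pw2 hι 3
  obtain ⟨i2⟩ := iso_pw2 hι 6
  obtain ⟨i3⟩ := iso_tensor ι hι (iso_pw1 ι 3) (iso_pw1 ι 6)
  obtain ⟨i4⟩ := iso_tensor ι hι (iso_pw2 hι 3) (iso_pw2 hι 6)
  have j1 : InAdd (Fam (Wm ι 3) (Wm ι 6)) (Rp ι 4 rp1) :=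
    (good_s (n := 2) (m := 0) (by norm_num) (by norm_num)).iso (i1.symm ≪≫ (ρ_ _).symm)
  have j2 : InAdd (Fam (Wm ι 3) (Wm ι 6)) (Rp ι 4 rp2) :=
    (good_s (n := 0) (m := 2) (by norm_num) (by norm_num)).iso (i2.symm ≪≫ (λ_ _).symm)
  have j3 : InAdd (Fam (Wm ι 3) (Wm ι 6)) (Rp ι 4 rp3) :=
    (good_s (n := 1) (m := 1) (by norm_num) (by norm_num)).iso i3.symm
  have j4 : InAdd (Fam (Wm ι 3) (Wm ι 6)) (Rp ι 16 rp4) :=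
    (good_s (n := 2) (m := 2) (by norm_num) (by norm_num)).iso i4.symm
  rcases h with h | h | h | h
  · obtain ⟨e⟩ := bc_iso (K := K) (ι := ι) h ckb.1
    exact (cert1 hι j1 ck1).iso e
  · obtain ⟨e⟩ := bc_iso (K := K) (ι := ι) h ckb.2.1
    exact (cert1 hι j3 ck4).iso e
  · obtain ⟨e⟩ := bc_iso (K := K) (ι := ι) h ckb.2.2.1
    refine InAdd.iso ?_ e
    obtain ⟨f, hf⟩ := exists_hom ι hι P6a ck6.1
    obtain ⟨g, hg⟩ := exists_hom ι hι Q6a ck6.2.1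
    obtain ⟨f', hf'⟩ := exists_hom ι hι P6b ck6.2.2.1
    obtain ⟨g', hg'⟩ := exists_hom ι hι Q6b ck6.2.2.2.1
    have e := eqc_spec (ι := ι) ck6.2.2.2.2
    apply TM.inAdd
    rw [← dm_pm_id, ← e]
    have : dm ι 6 6 (fun i j => ad (mm 4 Q6a P6a i j) (mm 4 Q6b P6b i j)) =
        dm ι 6 4 Q6a * dm ι 4 6 P6a + dm ι 6 4 Q6b * dm ι 4 6 P6b := by
      rw [← dm_mm hι, ← dm_mm hι]
      ext i j
      simp only [dm, Matrix.of_apply, dec_ad, Matrix.add_apply]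
    rw [this]
    exact TM.add ⟨f ≫ g, j1.thru _ _, MH.comp hf hg⟩ ⟨f' ≫ g', j2.thru _ _, MH.comp hf' hg'⟩
  · obtain ⟨e⟩ := bc_iso (K := K) (ι := ι) h ckb.2.2.2
    exact (cert1 hι j4 ck9).iso e
end
end AlgMod
namespace AlgMod
/-- first three-cycle -/
def ca : Equiv.Perm (Fin 6) := ⟨![1, 2, 0, 3, 4, 5], ![2, 0, 1, 3, 4, 5], by decide, by decide⟩
/-- second three-cycle -/
def cb : Equiv.Perm (Fin 6) := ⟨![0, 1, 2, 4, 5, 3], ![0, 1, 2, 5, 3, 4], by decide, by decide⟩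
/-- the Sylow subgroup as an image of a free monoid -/
def phi : FreeMonoid Bool →* Equiv.Perm (Fin 6) := FreeMonoid.lift fun c => cond c cb ca

lemma cent_list : ∀ h : Equiv.Perm (Fin 6), h * ca = ca * h → h * cb = cb * h →
    ∃ i : Fin 3, ∃ j : Fin 3, ca ^ (i : ℕ) * cb ^ (j : ℕ) = h := by
  decide +kernel

/-- the Sylow subgroup -/
def sylH : Subgroup (Equiv.Perm (Fin 6)) := Subgroup.centralizer {ca, cb}

lemma mem_sylH (h : Equiv.Perm (Fin 6)) : h ∈ sylH ↔ h * ca = ca * h ∧ h * cb = cb * h := by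
  rw [sylH, Subgroup.mem_centralizer_iff]
  simp [eq_comm]

lemma sylH_phi : ∀ h ∈ sylH, ∃ γ, phi γ = h := by
  intro h hh
  rw [mem_sylH] at hh
  obtain ⟨i, j, e⟩ := cent_list h hh.1 hh.2
  refine ⟨FreeMonoid.of false ^ (i : ℕ) * FreeMonoid.of true ^ (j : ℕ), ?_⟩
  rw [map_mul, map_pow, map_pow, ← e]
  rfl

lemma sylH_index (k : Type) [Field k] [CharP k 3] : (sylH.index : k) ≠ 0 := by
  have hc : Nat.card sylH = 9 := by
    have e : Function.Bijective (fun x : Fin 3 × Fin 3 =>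
      (⟨ca ^ (x.1 : ℕ) * cb ^ (x.2 : ℕ), by
        rw [mem_sylH]; revert x; decide +kernel⟩ : sylH)) := by
      constructor
      · intro x y h
        have h := congrArg Subtype.val h
        revert x y
        decide +kernel
      · rintro ⟨h, hh⟩
        have hh' := hh
        rw [mem_sylH] at hh
        obtain ⟨i, j, e⟩ := cent_list h hh.1 hh.2
        exact ⟨(i, j), Subtype.ext e⟩
    rw [← Nat.card_eq_of_bijective _ e]
    simp
  have h1 := sylH.index_mul_card
  rw [hc, Nat.card_perm, Nat.card_eq_fintype_card, Fintype.card_fin] at h1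
  have : sylH.index = 80 := by
    have : Nat.factorial 6 = 720 := rfl
    omega
  rw [this]
  intro h
  have := (CharP.cast_eq_zero_iff k 3 80).1 h
  omega
end AlgMod
namespace AlgMod
/-- transposition (2 3) -/
def cs : Equiv.Perm (Fin 6) := Equiv.swap 2 3
/-- transposition (0 1) -/
def ct : Equiv.Perm (Fin 6) := Equiv.swap 0 1
/-- transposition (3 4) -/
def cu : Equiv.Perm (Fin 6) := Equiv.swap 3 4

/-- sums of natural numbers -/
def sm : ℕ → (ℕ → ℕ) → ℕ
  | 0, _ => 0
  | n + 1, f => sm n f + f n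
/-- product of natural matrices -/
def mn (n : ℕ) (A B : ℕ → ℕ → ℕ) (i j : ℕ) : ℕ := sm n fun l => lz (A i l) (B l j)
/-- congruence of matrices -/
def eq3 (M N : ℕ) (A B : ℕ → ℕ → ℕ) : Bool :=
  al M fun i => al N fun j => Nat.beq (A i j % 3) (B i j % 3)
/-- block check -/
def okB (o d : ℕ) (A M : ℕ → ℕ → ℕ) : Bool :=
  and (al d fun j => al d fun i => Nat.beq (A (o + i) (o + j) % 3) (M i j % 3))
  (al d fun j => al (20 - (o + d)) fun r => Nat.beq (A (o + d + r) (o + j) % 3) 0)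

section
variable {k V : Type} [Field k] [CharP k 3] [AddCommGroup V] [Module k V]

omit [CharP k 3] in
lemma sm_cast (n : ℕ) (f : ℕ → ℕ) : ((sm n f : ℕ) : k) = ∑ i ∈ Finset.range n, (f i : k) := by
  induction n with
  | zero => simp [sm]
  | succ n ih => rw [sm, Nat.cast_add, ih, Finset.sum_range_succ]

lemma cast3 {a b : ℕ} (h : a % 3 = b % 3) : (a : k) = (b : k) := by
  rw [CharP.cast_eq_mod k 3 a, h, ← CharP.cast_eq_mod k 3 b]

lemma lz_cast (a b : ℕ) (ha : a < 3) (hb : b < 3) : ((lz a b : ℕ) : k) = (a : k) * b := by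
  rw [← Nat.cast_mul]
  apply cast3
  have : ∀ a < 3, ∀ b < 3, lz a b % 3 = a * b % 3 := by decide +kernel
  exact this a ha b hb

/-- bounded entries -/
def Sml (A : ℕ → ℕ → ℕ) : Prop := ∀ i j, A i j < 3

lemma mn_cast {n : ℕ} {A B : ℕ → ℕ → ℕ} (hA : Sml A) (hB : Sml B) (i j : ℕ) :
    ((mn n A B i j : ℕ) : k) = ∑ l ∈ Finset.range n, (A i l : k) * (B l j : k) := by
  rw [mn, sm_cast]
  exact Finset.sum_congr rfl fun l _ => lz_cast _ _ (hA _ _) (hB _ _)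

lemma al_nat {n : ℕ} {f : ℕ → Bool} (h : al n f = true) : ∀ i < n, f i = true :=
  fun i hi => al_spec h ⟨i, hi⟩

lemma eq3_cast {M N : ℕ} {A B : ℕ → ℕ → ℕ} (h : eq3 M N A B = true) {i j : ℕ} (hi : i < M)
    (hj : j < N) : (A i j : k) = (B i j : k) :=
  cast3 (Nat.eq_of_beq_eq_true (al_nat (al_nat h i hi) j hj))

/-- the operator `X` acts on the family by a matrix -/
def Rep (k : Type) {V : Type} [Field k] [AddCommGroup V] [Module k V] (n : ℕ) (v : ℕ → V)
    (X : V →ₗ[k] V) (A : ℕ → ℕ → ℕ) : Prop :=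
  ∀ j < n, X (v j) = ∑ i ∈ Finset.range n, (A i j : k) • v i

/-- new family -/
def nf (k : Type) {V : Type} [Field k] [AddCommGroup V] [Module k V] (n : ℕ) (E : ℕ → V)
    (B : ℕ → ℕ → ℕ) (j : ℕ) : V := ∑ i ∈ Finset.range n, (B i j : k) • E i

lemma nf_nf {n : ℕ} {E : ℕ → V} {A B : ℕ → ℕ → ℕ} (hA : Sml A) (hB : Sml B) (j : ℕ) :
    nf k n (nf k n E A) B j = ∑ i ∈ Finset.range n, ((mn n A B i j : ℕ) : k) • E i := by
  simp only [nf, Finset.smul_sum, smul_smul]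
  rw [Finset.sum_comm]
  refine Finset.sum_congr rfl fun i _ => ?_
  rw [mn_cast hA hB, Finset.sum_smul]
  exact Finset.sum_congr rfl fun l _ => by rw [mul_comm]

lemma Rep.change {n : ℕ} {E : ℕ → V} {X : V →ₗ[k] V} {P A B : ℕ → ℕ → ℕ} (h : Rep k n E X P)
    (hA : Sml A) (hB : Sml B) (hP : Sml P) (e : eq3 n n (mn n P B) (mn n B A) = true) :
    Rep k n (nf k n E B) X A := by
  intro j hj
  have h1 : X (nf k n E B j) = nf k n (nf k n E P) B j := by
    rw [nf, map_sum, nf]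
    refine Finset.sum_congr rfl fun i hi => ?_
    rw [map_smul, h i (Finset.mem_range.1 hi), nf]
  rw [h1, nf_nf hP hB]
  change _ = nf k n (nf k n E B) A j
  rw [nf_nf hB hA]
  exact Finset.sum_congr rfl fun i hi => by rw [eq3_cast e (Finset.mem_range.1 hi) hj]

lemma nf_inv {n : ℕ} {E : ℕ → V} {B C : ℕ → ℕ → ℕ} (hC : Sml C) (hB : Sml B)
    (e : eq3 n n (mn n B C) (pm id) = true) (h0 : ∀ j < n, nf k n E B j = 0) :
    ∀ j < n, E j = 0 := by
  intro j hj
  have h1 : nf k n (nf k n E B) C j = 0 := by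
    rw [nf]
    exact Finset.sum_eq_zero fun i hi => by rw [h0 i (Finset.mem_range.1 hi), smul_zero]
  rw [nf_nf hB hC, Finset.sum_eq_single j, eq3_cast e hj hj] at h1
  · simpa [pm] using h1
  · intro b hb hbj
    rw [eq3_cast e (Finset.mem_range.1 hb) hj]
    have : Nat.beq b j = false := by
      rw [Bool.eq_false_iff]; exact fun h' => hbj (Nat.eq_of_beq_eq_true h')
    simp [pm, this]
  · intro h; exact absurd (Finset.mem_range.2 hj) h

lemma Rep.block {v : ℕ → V} {X : V →ₗ[k] V} {A M : ℕ → ℕ → ℕ} (h : Rep k 20 v X A) (o d : ℕ)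
    (hod : o + d ≤ 20) (h0 : ∀ n < o, v n = 0) (e : okB o d A M = true) :
    Rep k d (fun j => v (o + j)) X M := by
  intro j hj
  rw [okB, Bool.and_eq_true] at e
  obtain ⟨r, hr⟩ := Nat.exists_eq_add_of_le hod
  rw [h (o + j) (by omega), hr, Finset.sum_range_add, Finset.sum_range_add,
    Finset.sum_eq_zero (s := Finset.range o), zero_add]
  · rw [Finset.sum_eq_zero (s := Finset.range r), add_zero]
    · refine Finset.sum_congr rfl fun i hi => ?_
      rw [cast3 (Nat.eq_of_beq_eq_true (al_nat (al_nat e.1 j hj) i (Finset.mem_range.1 hi)))]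
    · intro i hi
      have h2 := al_nat (al_nat e.2 j hj) i (by have := Finset.mem_range.1 hi; omega)
      have h3 : ((A (o + d + i) (o + j) : ℕ) : k) = ((0 : ℕ) : k) := cast3 (Nat.eq_of_beq_eq_true h2)
      rw [h3, Nat.cast_zero, zero_smul]
  · intro i hi
    rw [h0 i (Finset.mem_range.1 hi), smul_zero]

omit [CharP k 3] in
lemma li_tri {d : ℕ} {v : Fin d → V} (T : Fin d → (V →ₗ[k] V)) (h1 : ∀ j, T j (v j) ≠ 0)
    (h2 : ∀ j l, j < l → T j (v l) = 0) : LinearIndependent k v := by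
  rw [Fintype.linearIndependent_iff]
  intro c hc i
  induction i using WellFoundedLT.induction with
  | _ i ih =>
    have h := congrArg (T i) hc
    rw [map_sum, map_zero, Finset.sum_eq_single i] at h
    · rw [map_smul] at h
      exact (smul_eq_zero.1 h).resolve_right (h1 i)
    · intro j _ hj
      rw [map_smul]
      rcases lt_or_gt_of_ne hj with hj | hj
      · rw [ih j hj, zero_smul]
      · rw [h2 i j hj, smul_zero]
    · intro h; exact absurd (Finset.mem_univ i) h
end
end AlgMod
namespace AlgMod
section
variable {k V : Type} [Field k] [CharP k 3] [AddCommGroup V] [Module k V]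

/-- irreducibility -/
def Irr (ρ : Equiv.Perm (Fin 6) →* (V →ₗ[k] V)) : Prop :=
  ∀ U : Submodule k V, (∀ g, ∀ u ∈ U, ρ g u ∈ U) → U = ⊥ ∨ U = ⊤

/-- prescribed action of the two three-cycles -/
def Typ (ρ : Equiv.Perm (Fin 6) →* (V →ₗ[k] V)) (d : ℕ) (α : Bool → ℕ → ℕ → ℕ) : Prop :=
  ∃ b : Module.Basis (Fin d) k V, ∀ c j,
    ρ (cond c cb ca) (b j) = ∑ i : Fin d, ((α c i j : ℕ) : k) • b i

/-- the four possibilities -/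
def Cls (ρ : Equiv.Perm (Fin 6) →* (V →ₗ[k] V)) : Prop :=
  Typ ρ 1 ty1 ∨ Typ ρ 4 ty4 ∨ Typ ρ 6 ty6 ∨ Typ ρ 9 ty9

omit [CharP k 3] in
lemma gen_stable (ρ : Equiv.Perm (Fin 6) →* (V →ₗ[k] V)) (U : Submodule k V)
    (ha : ∀ u ∈ U, ρ ca u ∈ U) (hb : ∀ u ∈ U, ρ cb u ∈ U) (hs : ∀ u ∈ U, ρ cs u ∈ U) :
    ∀ g, ∀ u ∈ U, ρ g u ∈ U := by
  let N : Submonoid (Equiv.Perm (Fin 6)) :=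
    { carrier := {g | ∀ u ∈ U, ρ g u ∈ U}
      one_mem' := fun u hu => by simpa using hu
      mul_mem' := fun {g h} hg hh u hu => by
        rw [map_mul]; exact hg _ (hh _ hu) }
  have na : ca ∈ N := ha
  have nb : cb ∈ N := hb
  have ns : cs ∈ N := hs
  have n03 : Equiv.swap 0 3 ∈ N := by
    have : (Equiv.swap 0 3 : Equiv.Perm (Fin 6)) = ca * cs * (ca * ca) := by decide
    rw [this]; exact mul_mem (mul_mem na ns) (mul_mem na na)
  have n13 : Equiv.swap 1 3 ∈ N := by
    have : (Equiv.swap 1 3 : Equiv.Perm (Fin 6)) = (ca * ca) * cs * ca := by decide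
    rw [this]; exact mul_mem (mul_mem (mul_mem na na) ns) na
  have n01 : Equiv.swap 0 1 ∈ N := by
    have : (Equiv.swap 0 1 : Equiv.Perm (Fin 6)) = Equiv.swap 0 3 * Equiv.swap 1 3 * Equiv.swap 0 3 := by
      decide
    rw [this]; exact mul_mem (mul_mem n03 n13) n03
  have n12 : Equiv.swap 1 2 ∈ N := by
    have : (Equiv.swap 1 2 : Equiv.Perm (Fin 6)) = ca * Equiv.swap 0 1 * (ca * ca) := by decide
    rw [this]; exact mul_mem (mul_mem na n01) (mul_mem na na)
  have n24 : Equiv.swap 2 4 ∈ N := by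
    have : (Equiv.swap 2 4 : Equiv.Perm (Fin 6)) = cb * cs * (cb * cb) := by decide
    rw [this]; exact mul_mem (mul_mem nb ns) (mul_mem nb nb)
  have n34 : Equiv.swap 3 4 ∈ N := by
    have : (Equiv.swap 3 4 : Equiv.Perm (Fin 6)) = cs * Equiv.swap 2 4 * cs := by decide
    rw [this]; exact mul_mem (mul_mem ns n24) ns
  have n45 : Equiv.swap 4 5 ∈ N := by
    have : (Equiv.swap 4 5 : Equiv.Perm (Fin 6)) = cb * Equiv.swap 3 4 * (cb * cb) := by decide
    rw [this]; exact mul_mem (mul_mem nb n34) (mul_mem nb nb)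
  have hN : N = ⊤ := by
    rw [eq_top_iff, ← Equiv.Perm.mclosure_swap_castSucc_succ 5, Submonoid.closure_le]
    rintro _ ⟨i, rfl⟩
    fin_cases i
    · exact n01
    · exact n12
    · exact ns
    · exact n34
    · exact n45
  intro g
  have : g ∈ N := by rw [hN]; trivial
  exact this

omit [CharP k 3] in
lemma blk_typ {ρ : Equiv.Perm (Fin 6) →* (V →ₗ[k] V)} (hi : Irr ρ) {d : ℕ} (hd : 0 < d)
    {v : ℕ → V} {α : Bool → ℕ → ℕ → ℕ} {S : ℕ → ℕ → ℕ}
    (ha : Rep k d v (ρ ca) (α false)) (hb : Rep k d v (ρ cb) (α true)) (hs : Rep k d v (ρ cs) S)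
    (hl : LinearIndependent k fun i : Fin d => v i) : Typ ρ d α := by
  have key : ∀ (X : V →ₗ[k] V) (A : ℕ → ℕ → ℕ), Rep k d v X A →
      ∀ u ∈ Submodule.span k (Set.range fun i : Fin d => v i),
        X u ∈ Submodule.span k (Set.range fun i : Fin d => v i) := by
    intro X A h u hu
    induction hu using Submodule.span_induction with
    | mem x hx =>
      obtain ⟨i, rfl⟩ := hx
      rw [h i i.2]
      exact Submodule.sum_mem _ fun l hl => Submodule.smul_mem _ _
        (Submodule.subset_span ⟨⟨l, Finset.mem_range.1 hl⟩, rfl⟩)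
    | zero => simp
    | add x y _ _ hx hy => rw [map_add]; exact add_mem hx hy
    | smul c x _ hx => rw [map_smul]; exact Submodule.smul_mem _ _ hx
  have ht := (hi _ (gen_stable ρ _ (key _ _ ha) (key _ _ hb) (key _ _ hs))).resolve_left (by
    intro h0
    have h1 : v 0 ∈ Submodule.span k (Set.range fun i : Fin d => v i) :=
      Submodule.subset_span ⟨⟨0, hd⟩, rfl⟩
    rw [h0, Submodule.mem_bot] at h1
    exact hl.ne_zero ⟨0, hd⟩ h1)
  refine ⟨Module.Basis.mk hl ht.ge, fun c j => ?_⟩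
  simp only [Module.Basis.mk_apply]
  rw [← Finset.sum_range (fun i => ((α c i j : ℕ) : k) • v i)]
  cases c
  · exact ha j j.2
  · exact hb j j.2

lemma two_eq : (2 : k) = -1 := by
  have h : ((3 : ℕ) : k) = 0 := CharP.cast_eq_zero k 3
  push_cast at h
  linear_combination h

/-- matrices of cs -/
def S4 : ℕ → ℕ → ℕ := lk 72621643806089472 4
/-- matrices of cs -/
def S6 : ℕ → ℕ → ℕ := lk 42701817067463830236389118860475834912 6
/-- matrices of ct -/
def T6 : ℕ → ℕ → ℕ := lk 1393796585333322521384125153401051975516162 6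
/-- matrices of cs -/
def S9 : ℕ → ℕ → ℕ := lk 284731041249307045220513360182195228627170492584089476790335976131292349192866531285680639840784 9

lemma step1 {ρ : Equiv.Perm (Fin 6) →* (V →ₗ[k] V)} (hi : Irr ρ) {v : ℕ → V} {S : ℕ → ℕ → ℕ}
    (ha : Rep k 1 v (ρ ca) (ty1 false)) (hb : Rep k 1 v (ρ cb) (ty1 true))
    (hs : Rep k 1 v (ρ cs) S) : Cls ρ ∨ ∀ j < 1, v j = 0 := by
  by_cases h : v 0 = 0
  · right; intro j hj; obtain rfl : j = 0 := by omega
    exact h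
  · left; left
    refine blk_typ hi one_pos ha hb hs ?_
    refine li_tri (fun _ => 1) (fun j => ?_) (fun j l h => ?_)
    · obtain rfl : j = 0 := Subsingleton.elim _ _
      simpa using h
    · omega

lemma step4 {ρ : Equiv.Perm (Fin 6) →* (V →ₗ[k] V)} (hi : Irr ρ) {v : ℕ → V} {ε : ℕ}
    (he : (ε : k) ≠ 0)
    (ha : Rep k 4 v (ρ ca) (ty4 false)) (hb : Rep k 4 v (ρ cb) (ty4 true))
    (hs : Rep k 4 v (ρ cs) (fun i j => ε * S4 i j)) : Cls ρ ∨ ∀ j < 4, v j = 0 := by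
  have n2 : (2 : k) ≠ 0 := by rw [two_eq]; simp
  have sy : ∀ w : V, 0 = w ↔ w = 0 := fun w => eq_comm
  obtain ⟨x, hx⟩ : ∃ x : V →ₗ[k] V, x = ρ ca - 1 := ⟨_, rfl⟩
  obtain ⟨y, hy⟩ : ∃ y : V →ₗ[k] V, y = ρ cb - 1 := ⟨_, rfl⟩
  have x0 : x (v 0) = v 1 := by
    rw [hx]; simp [ha 0 (by norm_num), Finset.sum_range_succ, ty4, lk]
  have x1 : x (v 1) = v 3 := by
    rw [hx]; simp [ha 1 (by norm_num), Finset.sum_range_succ, ty4, lk]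
  have x2 : x (v 2) = 0 := by
    rw [hx]; simp [ha 2 (by norm_num), Finset.sum_range_succ, ty4, lk]
  have x3 : x (v 3) = 0 := by
    rw [hx]; simp [ha 3 (by norm_num), Finset.sum_range_succ, ty4, lk]
  have y0 : y (v 0) = v 2 := by
    rw [hy]; simp [hb 0 (by norm_num), Finset.sum_range_succ, ty4, lk]
  have y2 : y (v 2) = v 3 := by
    rw [hy]; simp [hb 2 (by norm_num), Finset.sum_range_succ, ty4, lk]
  have y3 : y (v 3) = 0 := by
    rw [hy]; simp [hb 3 (by norm_num), Finset.sum_range_succ, ty4, lk]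
  by_cases h : v 3 = 0
  · right
    have h1 := hs 3 (by norm_num)
    simp [h, Finset.sum_range_succ, S4, lk, sy] at h1
    have h2 := congrArg x h1
    simp [x0, x1, h, he, n2, sy] at h2
    rw [h2] at h1
    simp [he, n2] at h1
    have h3 : v 2 = 0 := by rw [← y0, h1, map_zero]
    intro j hj
    interval_cases j <;> assumption
  · left; right; left
    refine blk_typ hi (by norm_num) ha hb hs ?_
    refine li_tri ![x * x, x, y, 1] (fun j => ?_) (fun j l hl => ?_)
    · fin_cases j <;> simp [x0, x1, x2, y2, h]
    · fin_cases j <;> fin_cases l <;> simp [x0, x1, x2, x3, y2, y3] at hl ⊢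

lemma step6 {ρ : Equiv.Perm (Fin 6) →* (V →ₗ[k] V)} (hi : Irr ρ) {v : ℕ → V}
    (ha : Rep k 6 v (ρ ca) (ty6 false)) (hb : Rep k 6 v (ρ cb) (ty6 true))
    (hs : Rep k 6 v (ρ cs) S6) (ht : Rep k 6 v (ρ ct) T6) : Cls ρ ∨ ∀ j < 6, v j = 0 := by
  have n2 : (2 : k) ≠ 0 := by rw [two_eq]; simp
  have sy : ∀ w : V, 0 = w ↔ w = 0 := fun w => eq_comm
  obtain ⟨x, hx⟩ : ∃ x : V →ₗ[k] V, x = ρ ca - 1 := ⟨_, rfl⟩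
  obtain ⟨y, hy⟩ : ∃ y : V →ₗ[k] V, y = ρ cb - 1 := ⟨_, rfl⟩
  obtain ⟨p, hp⟩ : ∃ p : V →ₗ[k] V, p = ρ ct - 1 := ⟨_, rfl⟩
  obtain ⟨q, hq⟩ : ∃ q : V →ₗ[k] V, q = ρ ct + 1 := ⟨_, rfl⟩
  have x0 : x (v 0) = v 2 := by
    rw [hx]; simp [ha 0 (by norm_num), Finset.sum_range_succ, ty6, lk]
  have x1 : x (v 1) = v 3 := by
    rw [hx]; simp [ha 1 (by norm_num), Finset.sum_range_succ, ty6, lk]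
  have x2 : x (v 2) = v 4 := by
    rw [hx]; simp [ha 2 (by norm_num), Finset.sum_range_succ, ty6, lk]
  have x3 : x (v 3) = v 5 := by
    rw [hx]; simp [ha 3 (by norm_num), Finset.sum_range_succ, ty6, lk]
  have x4 : x (v 4) = 0 := by
    rw [hx]; simp [ha 4 (by norm_num), Finset.sum_range_succ, ty6, lk]
  have x5 : x (v 5) = 0 := by
    rw [hx]; simp [ha 5 (by norm_num), Finset.sum_range_succ, ty6, lk]
  have y0 : y (v 0) = (2 : k) • v 3 := by
    rw [hy]; simp [hb 0 (by norm_num), Finset.sum_range_succ, ty6, lk]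
  have y1 : y (v 1) = v 2 + (2 : k) • v 4 + (2 : k) • v 5 := by
    rw [hy]; simp [hb 1 (by norm_num), Finset.sum_range_succ, ty6, lk]; abel
  have y2 : y (v 2) = (2 : k) • v 5 := by
    rw [hy]; simp [hb 2 (by norm_num), Finset.sum_range_succ, ty6, lk]
  have y3 : y (v 3) = v 4 := by
    rw [hy]; simp [hb 3 (by norm_num), Finset.sum_range_succ, ty6, lk]
  have y4 : y (v 4) = 0 := by
    rw [hy]; simp [hb 4 (by norm_num), Finset.sum_range_succ, ty6, lk]
  have p4 : p (v 4) = v 4 := by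
    rw [hp]; simp [ht 4 (by norm_num), Finset.sum_range_succ, T6, lk]
    rw [two_smul]; abel
  have p5 : p (v 5) = 0 := by
    rw [hp]; simp [ht 5 (by norm_num), Finset.sum_range_succ, T6, lk]
  have q4 : q (v 4) = 0 := by
    rw [hq]; simp [ht 4 (by norm_num), Finset.sum_range_succ, T6, lk]
    rw [two_eq]; simp
  have q5 : q (v 5) = (2 : k) • v 5 := by
    rw [hq]; simp [ht 5 (by norm_num), Finset.sum_range_succ, T6, lk]
    rw [two_smul]
  have s4 := hs 4 (by norm_num)
  have s5 := hs 5 (by norm_num)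
  simp [Finset.sum_range_succ, S6, lk] at s4 s5
  have hA : v 4 = 0 → ∀ j < 6, v j = 0 := by
    intro h4
    simp [h4, sy] at s4
    have h2 : v 2 = 0 := by rw [← x0, s4, map_zero]
    have h3 : v 3 = 0 := by
      rw [s4, map_zero] at y0
      exact (smul_eq_zero.1 y0.symm).resolve_left n2
    have h5 : v 5 = 0 := by rw [← x3, h3, map_zero]
    simp [h2, h3, h4, h5, n2, sy] at s5
    intro j hj
    interval_cases j <;> assumption
  have hB : v 5 = 0 → ∀ j < 6, v j = 0 := by
    intro h5
    apply hA
    simp [h5, sy] at s5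
    have e1 := congrArg y s5
    simp [y1, y2, y3, y4, h5, sy] at e1
    have e2 := congrArg x e1
    simp [x2, x4, n2, sy] at e2
    exact e2
  by_cases h4 : v 4 = 0
  · exact Or.inr (hA h4)
  by_cases h5 : v 5 = 0
  · exact Or.inr (hB h5)
  left; right; right; left
  refine blk_typ hi (by norm_num) ha hb hs ?_
  refine li_tri ![p * x * x, q * x * x, p * x, q * x, p, 1] (fun j => ?_) (fun j l hl => ?_)
  · fin_cases j <;> simp [x0, x1, x2, x3, p4, q5, h4, h5, n2]
  · fin_cases j <;> fin_cases l <;> simp [x0, x1, x2, x3, x4, x5, p4, p5, q4] at hl ⊢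

lemma step9 {ρ : Equiv.Perm (Fin 6) →* (V →ₗ[k] V)} (hi : Irr ρ) {v : ℕ → V}
    (ha : Rep k 9 v (ρ ca) (ty9 false)) (hb : Rep k 9 v (ρ cb) (ty9 true))
    (hs : Rep k 9 v (ρ cs) S9) : Cls ρ ∨ ∀ j < 9, v j = 0 := by
  have n2 : (2 : k) ≠ 0 := by rw [two_eq]; simp
  have sy : ∀ w : V, 0 = w ↔ w = 0 := fun w => eq_comm
  obtain ⟨x, hx⟩ : ∃ x : V →ₗ[k] V, x = ρ ca - 1 := ⟨_, rfl⟩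
  obtain ⟨y, hy⟩ : ∃ y : V →ₗ[k] V, y = ρ cb - 1 := ⟨_, rfl⟩
  have x0 : ∀ j < 6, x (v j) = v (j + 3) := by
    intro j hj
    rw [hx]
    interval_cases j <;> simp [ha _ (Nat.lt_of_lt_of_le hj (by norm_num : 6 ≤ 9)),
      ha 0 (by norm_num), ha 1 (by norm_num), ha 2 (by norm_num), ha 3 (by norm_num),
      ha 4 (by norm_num), ha 5 (by norm_num), Finset.sum_range_succ, ty9, lk]
  have x6 : ∀ j < 3, x (v (6 + j)) = 0 := by
    intro j hj
    rw [hx]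
    interval_cases j <;> simp [ha 6 (by norm_num), ha 7 (by norm_num), ha 8 (by norm_num),
      Finset.sum_range_succ, ty9, lk]
  have y6 : y (v 6) = v 7 := by
    rw [hy]; simp [hb 6 (by norm_num), Finset.sum_range_succ, ty9, lk]
  have y7 : y (v 7) = v 8 := by
    rw [hy]; simp [hb 7 (by norm_num), Finset.sum_range_succ, ty9, lk]
  have y8 : y (v 8) = 0 := by
    rw [hy]; simp [hb 8 (by norm_num), Finset.sum_range_succ, ty9, lk]
  have y0 : y (v 0) = v 1 := by
    rw [hy]; simp [hb 0 (by norm_num), Finset.sum_range_succ, ty9, lk]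
  have y1 : y (v 1) = v 2 := by
    rw [hy]; simp [hb 1 (by norm_num), Finset.sum_range_succ, ty9, lk]
  have a0 := x0 0 (by norm_num)
  have a1 := x0 1 (by norm_num)
  have a2 := x0 2 (by norm_num)
  have a3 := x0 3 (by norm_num)
  have a4 := x0 4 (by norm_num)
  have a5 := x0 5 (by norm_num)
  have a6 := x6 0 (by norm_num)
  have a7 := x6 1 (by norm_num)
  have a8 := x6 2 (by norm_num)
  norm_num at a0 a1 a2 a3 a4 a5 a6 a7 a8
  by_cases h : v 8 = 0
  · right
    have s8 := hs 8 (by norm_num)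
    simp [Finset.sum_range_succ, S9, lk, h, n2, sy] at s8
    have h1 : v 1 = 0 := by rw [← y0, s8, map_zero]
    have h2 : v 2 = 0 := by rw [← y1, h1, map_zero]
    have h3 : v 3 = 0 := by rw [← a0, s8, map_zero]
    have h4 : v 4 = 0 := by rw [← a1, h1, map_zero]
    have h5 : v 5 = 0 := by rw [← a2, h2, map_zero]
    have h6 : v 6 = 0 := by rw [← a3, h3, map_zero]
    have h7 : v 7 = 0 := by rw [← a4, h4, map_zero]
    intro j hj
    interval_cases j <;> assumption
  · left; right; right; right
    refine blk_typ hi (by norm_num) ha hb hs ?_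
    refine li_tri ![y * y * x * x, y * x * x, x * x, y * y * x, y * x, x, y * y, y, 1]
      (fun j => ?_) (fun j l hl => ?_)
    · fin_cases j <;> simp [a0, a1, a2, a3, a4, a5, y6, y7, h]
    · fin_cases j <;> fin_cases l <;>
        simp [a0, a1, a2, a3, a4, a5, a6, a7, a8, y6, y7, y8] at hl ⊢
end
end AlgMod
namespace AlgMod
/-- coset representatives -/
def wd (n : ℕ) : Equiv.Perm (Fin 6) := ([1, cs, cb * cs, cb * cb * cs, ca * ca * cs,
  cb * ca * ca * cs, cb * cb * ca * ca * cs, cs * cb * ca * ca * cs, cs * cb * cb * ca * ca * cs, cb * cs * cb * ca * ca * cs,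
  ca * cs, cb * ca * cs, cb * cb * ca * cs, cs * cb * ca * cs, cs * cb * cb * ca * cs,
  cb * cs * cb * ca * cs, ca * cs * cb * ca * cs, ca * cs * cb * cb * ca * cs, cb * ca * cs * cb * ca * cs, cs * cb * ca * cs * cb * ca * cs] : List (Equiv.Perm (Fin 6))).getD n 1
/-- target of the action -/
def tg (X n : ℕ) : ℕ := (X >>> (6 * n)) % 32
/-- sign of the action -/
def tk (X n : ℕ) : ℕ := (X >>> (6 * n + 5)) % 2
/-- monomial matrix -/
def pmx (X τ i n : ℕ) : ℕ := cond (Nat.beq i (tg X n)) (cond (Nat.beq (tk X n) 1) τ 1) 0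
/-- lookup -/
def q4 (X i j : ℕ) : ℕ := ((X >>> (2 * (20 * i + j))) % 4) % 3

/-- action codes -/
def Xa : ℕ := 408125758559629910535602748777345664
/-- action codes -/
def Xb : ℕ := 410760843220328877779711040868855936
/-- action codes -/
def Xs : ℕ := 380263507608069128312622885265743873
/-- action codes -/
def Xt : ℕ := 400543414647137713083786061929130080

/-- correctness of an action code -/
def okX (g : Equiv.Perm (Fin 6)) (X : ℕ) : Prop := ∀ n : Fin 20, tg X n < 20 ∧ ∃ i j : Fin 3,
  ∃ l : Fin 2, g * wd n = wd (tg X n) * (ca ^ (i : ℕ) * cb ^ (j : ℕ) * ct ^ (tk X n) * cu ^ (l : ℕ))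

lemma okXa : okX ca Xa := by unfold okX; decide +kernel
lemma okXb : okX cb Xb := by unfold okX; decide +kernel
lemma okXs : okX cs Xs := by unfold okX; decide +kernel
lemma okXt : okX ct Xt := by unfold okX; decide +kernel

lemma sml_q4 (X : ℕ) : Sml (q4 X) := fun _ _ => Nat.mod_lt _ (by norm_num)
lemma sml_pt (X τ : ℕ) (h : τ < 3) : Sml (pmx X τ) := by
  intro i j
  unfold pmx
  cases Nat.beq i (tg X j) <;> cases Nat.beq (tk X j) 1 <;> simp [h]

set_option maxRecDepth 100000
/-- table -/
def BA : ℕ := 2645401211756427829001664512163976150691578000892206463334455726768732244790972920168775056228912993333175549688931030865566516029460495242478314026612735022360496184946464857103531780855654994181623617340920837888920505736740610519687233537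
/-- table -/
def IA : ℕ := 1667817624512186531403196448758782501041389478989000026286752404873927911256163618315590457421167545065152064308676954501314994144242965782116300126297722783968981438469175530128767657315221262042260866247242889038388197083463283543849828353
/-- table -/
def aA : ℕ := 1693050539598785454401987091889591282479055229497782582458120192582858808597011855247882668272602902133840147594375460675214570097264837246298074350809514650320652749753870528485353187496090825074851281562288379355630429233663555241154445313
/-- table -/
def bA : ℕ := 2083754510275428251571676399241672618001314704492022464286833222677598831724147541698832443996270438063427269972186247851964350325522815177012361409489137828030637876401759721526080029215116895598690527978637762554349971853517498723097116673
/-- table -/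
def sA : ℕ := 1096565636450394993238760140074681376777540195987600232229106257556147665907567697914415957251253648825316763160346714883867294664520756061957446101870005328673963518476032063642169992925440044601220069359638480837396726129146982197811479113
lemma kA : eq3 20 20 (mn 20 (pmx Xa 1) (q4 BA)) (mn 20 (q4 BA) (q4 aA)) = true ∧
    eq3 20 20 (mn 20 (pmx Xb 1) (q4 BA)) (mn 20 (q4 BA) (q4 bA)) = true ∧
    eq3 20 20 (mn 20 (pmx Xs 1) (q4 BA)) (mn 20 (q4 BA) (q4 sA)) = true ∧
    True ∧
    eq3 20 20 (mn 20 (q4 BA) (q4 IA)) (pm id) = true := by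
  decide +kernel
lemma kA1 : okB 0 1 (q4 aA) (ty1 false) = true ∧
    okB 0 1 (q4 bA) (ty1 true) = true ∧
    okB 0 1 (q4 sA) (fun _ _ => 1) = true := by
  decide +kernel
lemma kA2 : okB 1 4 (q4 aA) (ty4 false) = true ∧
    okB 1 4 (q4 bA) (ty4 true) = true ∧
    okB 1 4 (q4 sA) (fun i j => 1 * S4 i j) = true := by
  decide +kernel
lemma kA3 : okB 5 1 (q4 aA) (ty1 false) = true ∧
    okB 5 1 (q4 bA) (ty1 true) = true ∧
    okB 5 1 (q4 sA) (fun _ _ => 1) = true := by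
  decide +kernel
lemma kA4 : okB 6 1 (q4 aA) (ty1 false) = true ∧
    okB 6 1 (q4 bA) (ty1 true) = true ∧
    okB 6 1 (q4 sA) (fun _ _ => 2) = true := by
  decide +kernel
lemma kA5 : okB 7 4 (q4 aA) (ty4 false) = true ∧
    okB 7 4 (q4 bA) (ty4 true) = true ∧
    okB 7 4 (q4 sA) (fun i j => 1 * S4 i j) = true := by
  decide +kernel
lemma kA6 : okB 11 9 (q4 aA) (ty9 false) = true ∧
    okB 11 9 (q4 bA) (ty9 true) = true ∧
    okB 11 9 (q4 sA) S9 = true := by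
  decide +kernel
/-- table -/
def BC : ℕ := 1929126713981575170066022960756522572599308790320435190316710156090363474607062433958449745813538566915271971428465659627530444611299137113427831623082146099010846942474442107899848423188517847047860650620337987889797723328425359950865235969
/-- table -/
def IC : ℕ := 1830029074261447604173852713373370702281198126703163441437983680303415454668708509739167800101819054179080834603141724572456329078932610342144149242177293581592032518876700900972211707981536974940429701272714071355587250296130345288465383425
/-- table -/
def aC : ℕ := 1771191333734114013835924957669110880131934701628449192409988223490793225372941308419323429784291859550723060495269772268540696657605471773584404529490679743988329869553382954462743073223259804969199972332519635501334882201716424097386201089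
/-- table -/
def bC : ℕ := 1732120936666541531110039783370026194082789619785495967085576674447392198571403122819729152643525842951088062397672106731841507011678092009226061907278620618594289373508127216943105462013748100607975198163424729378363997965453574367329910785
/-- table -/
def sC : ℕ := 13023465692406189924278740612406107111230069382457911729497655502209961971679815316071885152353863721417251894134877100544793126617428761555151900405125629444949270432285440183478197546416287195001483708471796174173525116280083330459763112
/-- table -/
def tC : ℕ := 1667003608220769013086891593811488841609326678792813078164596210418077437029218536836173969005212881471847957957868186040471750313239642695911192272543813483255140255107725707722716837747120476187004869361453229020450413364928124777995960322
lemma kC : eq3 20 20 (mn 20 (pmx Xa 2) (q4 BC)) (mn 20 (q4 BC) (q4 aC)) = true ∧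
    eq3 20 20 (mn 20 (pmx Xb 2) (q4 BC)) (mn 20 (q4 BC) (q4 bC)) = true ∧
    eq3 20 20 (mn 20 (pmx Xs 2) (q4 BC)) (mn 20 (q4 BC) (q4 sC)) = true ∧
    eq3 20 20 (mn 20 (pmx Xt 2) (q4 BC)) (mn 20 (q4 BC) (q4 tC)) = true ∧
    eq3 20 20 (mn 20 (q4 BC) (q4 IC)) (pm id) = true := by
  decide +kernel
lemma kC1 : okB 0 6 (q4 aC) (ty6 false) = true ∧
    okB 0 6 (q4 bC) (ty6 true) = true ∧
    okB 0 6 (q4 sC) S6 = true ∧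
    okB 0 6 (q4 tC) T6 = true := by
  decide +kernel
lemma kC2 : okB 6 4 (q4 aC) (ty4 false) = true ∧
    okB 6 4 (q4 bC) (ty4 true) = true ∧
    okB 6 4 (q4 sC) (fun i j => 1 * S4 i j) = true := by
  decide +kernel
lemma kC3 : okB 10 4 (q4 aC) (ty4 false) = true ∧
    okB 10 4 (q4 bC) (ty4 true) = true ∧
    okB 10 4 (q4 sC) (fun i j => 2 * S4 i j) = true := by
  decide +kernel
lemma kC4 : okB 14 6 (q4 aC) (ty6 false) = true ∧
    okB 14 6 (q4 bC) (ty6 true) = true ∧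
    okB 14 6 (q4 sC) S6 = true ∧
    okB 14 6 (q4 tC) T6 = true := by
  decide +kernel


section
variable {k V : Type} [Field k] [AddCommGroup V] [Module k V]

lemma pow_fix {X : V →ₗ[k] V} {v : V} (h : X v = v) (i : ℕ) : (X ^ i) v = v := by
  induction i with
  | zero => simp
  | succ i ih => rw [pow_succ, Module.End.mul_apply, h, ih]

lemma rep_pt {ρ : Equiv.Perm (Fin 6) →* (V →ₗ[k] V)} {v : V} {τ : ℕ} {g : Equiv.Perm (Fin 6)}
    {X : ℕ} (ha : ρ ca v = v) (hb : ρ cb v = v) (hu : ρ cu v = v) (ht : ρ ct v = (τ : k) • v)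
    (hX : okX g X) : Rep k 20 (fun n => ρ (wd n) v) (ρ g) (pmx X τ) := by
  intro n hn
  obtain ⟨h1, i, j, l, e⟩ := hX ⟨n, hn⟩
  simp only at h1 e
  have e1 : ρ g (ρ (wd n) v) = ρ (g * wd n) v := by rw [map_mul]; rfl
  have e2 : (ρ ct ^ tk X n) v = ((cond (Nat.beq (tk X n) 1) τ 1 : ℕ) : k) • v := by
    have : tk X n < 2 := Nat.mod_lt _ (by norm_num)
    generalize tk X n = c at *
    interval_cases c
    · simp [show Nat.beq 0 1 = false from rfl]
    · simpa using ht
  rw [e1, e]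
  simp only [map_mul, map_pow, Module.End.mul_apply]
  rw [pow_fix hu, e2, map_smul, map_smul, pow_fix hb, pow_fix ha, map_smul]
  rw [Finset.sum_eq_single (tg X n)]
  · have : Nat.beq (tg X n) (tg X n) = true := by simp
    simp [pmx, this]
  · intro b _ hb
    have : Nat.beq b (tg X n) = false := by
      rw [Bool.eq_false_iff]; exact fun h' => hb (Nat.eq_of_beq_eq_true h')
    simp [pmx, this]
  · intro h; exact absurd (Finset.mem_range.2 h1) h

lemma ext0 {v : ℕ → V} {o d : ℕ} (h : ∀ n < o, v n = 0) (h' : ∀ j < d, v (o + j) = 0) :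
    ∀ n < o + d, v n = 0 := by
  intro n hn
  by_cases hno : n < o
  · exact h n hno
  · obtain ⟨j, rfl⟩ := Nat.exists_eq_add_of_le (not_lt.1 hno)
    exact h' j (by omega)

variable [CharP k 3]

lemma cls_A {ρ : Equiv.Perm (Fin 6) →* (V →ₗ[k] V)} (hi : Irr ρ) {v : V} (hv : v ≠ 0)
    (ha : ρ ca v = v) (hb : ρ cb v = v) (hu : ρ cu v = v) (ht : ρ ct v = v) : Cls ρ := by
  have ht' : ρ ct v = ((1 : ℕ) : k) • v := by simpa using ht
  have n2 : ((2 : ℕ) : k) ≠ 0 := by push_cast; rw [two_eq]; simp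
  have n1 : ((1 : ℕ) : k) ≠ 0 := by simp
  have r1 := (rep_pt ha hb hu ht' okXa).change (sml_q4 _) (sml_q4 _) (sml_pt _ _ (by decide)) kA.1
  have r2 := (rep_pt ha hb hu ht' okXb).change (sml_q4 _) (sml_q4 _) (sml_pt _ _ (by decide)) kA.2.1
  have r3 := (rep_pt ha hb hu ht' okXs).change (sml_q4 _) (sml_q4 _) (sml_pt _ _ (by decide)) kA.2.2.1
  have h0 : ∀ n < 0, nf k 20 (fun n => ρ (wd n) v) (q4 BA) n = 0 := fun n h => absurd h (by omega)
  rcases step1 hi (r1.block 0 1 (by norm_num) h0 kA1.1) (r2.block 0 1 (by norm_num) h0 kA1.2.1)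
    (r3.block 0 1 (by norm_num) h0 kA1.2.2) with h | h
  · exact h
  have h1 := ext0 h0 h
  rcases step4 hi n1 (r1.block 1 4 (by norm_num) h1 kA2.1) (r2.block 1 4 (by norm_num) h1 kA2.2.1)
    (r3.block 1 4 (by norm_num) h1 kA2.2.2) with h | h
  · exact h
  have h2 := ext0 h1 h
  rcases step1 hi (r1.block 5 1 (by norm_num) h2 kA3.1) (r2.block 5 1 (by norm_num) h2 kA3.2.1)
    (r3.block 5 1 (by norm_num) h2 kA3.2.2) with h | h
  · exact h
  have h3 := ext0 h2 h
  rcases step1 hi (r1.block 6 1 (by norm_num) h3 kA4.1) (r2.block 6 1 (by norm_num) h3 kA4.2.1)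
    (r3.block 6 1 (by norm_num) h3 kA4.2.2) with h | h
  · exact h
  have h4 := ext0 h3 h
  rcases step4 hi n1 (r1.block 7 4 (by norm_num) h4 kA5.1) (r2.block 7 4 (by norm_num) h4 kA5.2.1)
    (r3.block 7 4 (by norm_num) h4 kA5.2.2) with h | h
  · exact h
  have h5 := ext0 h4 h
  rcases step9 hi (r1.block 11 9 (by norm_num) h5 kA6.1) (r2.block 11 9 (by norm_num) h5 kA6.2.1)
    (r3.block 11 9 (by norm_num) h5 kA6.2.2) with h | h
  · exact h
  have h6 := nf_inv (sml_q4 _) (sml_q4 _) kA.2.2.2.2 (ext0 h5 h) 0 (by norm_num)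
  exact absurd (by simpa [wd] using h6) hv

lemma cls_C {ρ : Equiv.Perm (Fin 6) →* (V →ₗ[k] V)} (hi : Irr ρ) {v : V} (hv : v ≠ 0)
    (ha : ρ ca v = v) (hb : ρ cb v = v) (hu : ρ cu v = v) (ht : ρ ct v = -v) : Cls ρ := by
  have ht' : ρ ct v = ((2 : ℕ) : k) • v := by
    push_cast; rw [two_eq, ht]; simp
  have n2 : ((2 : ℕ) : k) ≠ 0 := by push_cast; rw [two_eq]; simp
  have n1 : ((1 : ℕ) : k) ≠ 0 := by simp
  have r1 := (rep_pt ha hb hu ht' okXa).change (sml_q4 _) (sml_q4 _) (sml_pt _ _ (by decide)) kC.1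
  have r2 := (rep_pt ha hb hu ht' okXb).change (sml_q4 _) (sml_q4 _) (sml_pt _ _ (by decide)) kC.2.1
  have r3 := (rep_pt ha hb hu ht' okXs).change (sml_q4 _) (sml_q4 _) (sml_pt _ _ (by decide)) kC.2.2.1
  have r4 := (rep_pt ha hb hu ht' okXt).change (sml_q4 _) (sml_q4 _) (sml_pt _ _ (by decide)) kC.2.2.2.1
  have h0 : ∀ n < 0, nf k 20 (fun n => ρ (wd n) v) (q4 BC) n = 0 := fun n h => absurd h (by omega)
  rcases step6 hi (r1.block 0 6 (by norm_num) h0 kC1.1) (r2.block 0 6 (by norm_num) h0 kC1.2.1)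
    (r3.block 0 6 (by norm_num) h0 kC1.2.2.1) (r4.block 0 6 (by norm_num) h0 kC1.2.2.2) with h | h
  · exact h
  have h1 := ext0 h0 h
  rcases step4 hi n1 (r1.block 6 4 (by norm_num) h1 kC2.1) (r2.block 6 4 (by norm_num) h1 kC2.2.1)
    (r3.block 6 4 (by norm_num) h1 kC2.2.2) with h | h
  · exact h
  have h2 := ext0 h1 h
  rcases step4 hi n2 (r1.block 10 4 (by norm_num) h2 kC3.1) (r2.block 10 4 (by norm_num) h2 kC3.2.1)
    (r3.block 10 4 (by norm_num) h2 kC3.2.2) with h | h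
  · exact h
  have h3 := ext0 h2 h
  rcases step6 hi (r1.block 14 6 (by norm_num) h3 kC4.1) (r2.block 14 6 (by norm_num) h3 kC4.2.1)
    (r3.block 14 6 (by norm_num) h3 kC4.2.2.1) (r4.block 14 6 (by norm_num) h3 kC4.2.2.2) with h | h
  · exact h
  have h6 := nf_inv (sml_q4 _) (sml_q4 _) kC.2.2.2.2 (ext0 h3 h) 0 (by norm_num)
  exact absurd (by simpa [wd] using h6) hv
end
end AlgMod
namespace AlgMod
section
variable {k V : Type} [Field k] [CharP k 3] [AddCommGroup V] [Module k V]

lemma cube_zero {X : V →ₗ[k] V} (h : X * X * X = 1) (v : V) :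
    (X - 1) ((X - 1) ((X - 1) v)) = 0 := by
  have h' : X (X (X v)) = v := by
    have := congrArg (fun Y : V →ₗ[k] V => Y v) h
    simpa using this
  have h3 : ∀ w : V, w + w + w = 0 := by
    intro w
    have e : ((3 : ℕ) : k) • w = 0 := by rw [CharP.cast_eq_zero k 3, zero_smul]
    rw [Nat.cast_smul_eq_nsmul] at e
    rw [← e]; abel
  simp only [LinearMap.sub_apply, Module.End.one_apply, map_sub, h']
  have e1 := h3 (X v)
  have e2 := h3 (X (X v))
  rw [← sub_eq_zero_of_eq (e1.trans e2.symm)]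
  abel

lemma ex_fix {X : V →ₗ[k] V} (h : X * X * X = 1) (Q : V → Prop) (hQ : ∀ w, Q w → Q (X w - w))
    (v : V) (hv : v ≠ 0) (hq : Q v) : ∃ w, w ≠ 0 ∧ Q w ∧ X w = w := by
  have hc := cube_zero h v
  simp only [LinearMap.sub_apply, Module.End.one_apply] at hc
  by_cases h1 : X v - v = 0
  · exact ⟨v, hv, hq, sub_eq_zero.1 h1⟩
  by_cases h2 : X (X v - v) - (X v - v) = 0
  · exact ⟨_, h1, hQ _ hq, sub_eq_zero.1 h2⟩
  · exact ⟨_, h2, hQ _ (hQ _ hq), sub_eq_zero.1 hc⟩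

omit [CharP k 3] in
lemma ex_sgn {X : V →ₗ[k] V} (h : X * X = 1) (Q : V → Prop) (hQ : ∀ w, Q w → Q (w + X w))
    (v : V) (hv : v ≠ 0) (hq : Q v) : ∃ w, w ≠ 0 ∧ Q w ∧ (X w = w ∨ X w = -w) := by
  have h' : X (X v) = v := by
    have := congrArg (fun Y : V →ₗ[k] V => Y v) h
    simpa using this
  by_cases h1 : v + X v = 0
  · exact ⟨v, hv, hq, Or.inr (eq_neg_of_add_eq_zero_right h1)⟩
  · refine ⟨_, h1, hQ _ hq, Or.inl ?_⟩
    rw [map_add, h', add_comm]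

omit [CharP k 3] in
lemma rho_rel (ρ : Equiv.Perm (Fin 6) →* (V →ₗ[k] V)) {g h p q : Equiv.Perm (Fin 6)}
    (e : g * h = p * q) (w : V) : ρ g (ρ h w) = ρ p (ρ q w) := by
  have := congrArg (fun z => ρ z w) e
  simpa using this

lemma ex_vec [Nontrivial V] (ρ : Equiv.Perm (Fin 6) →* (V →ₗ[k] V)) :
    ∃ v : V, v ≠ 0 ∧ (((ρ ca v = v ∧ ρ cb v = v) ∧ (ρ ct v = v ∨ ρ ct v = -v))) ∧
      (ρ cu v = v ∨ ρ cu v = -v) := by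
  obtain ⟨v, hv⟩ := exists_ne (0 : V)
  have a3 : ρ ca * ρ ca * ρ ca = 1 := by
    rw [← map_mul, ← map_mul, show ca * ca * ca = 1 by decide, map_one]
  have b3 : ρ cb * ρ cb * ρ cb = 1 := by
    rw [← map_mul, ← map_mul, show cb * cb * cb = 1 by decide, map_one]
  have t2 : ρ ct * ρ ct = 1 := by
    rw [← map_mul, show ct * ct = 1 by decide, map_one]
  have u2 : ρ cu * ρ cu = 1 := by
    rw [← map_mul, show cu * cu = 1 by decide, map_one]
  have rab := rho_rel ρ (show ca * cb = cb * ca by decide)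
  have rat := rho_rel ρ (show ca * ct = ct * (ca * ca) by decide)
  have rbt := rho_rel ρ (show cb * ct = ct * cb by decide)
  have rau := rho_rel ρ (show ca * cu = cu * ca by decide)
  have rbu := rho_rel ρ (show cb * cu = cu * (cb * cb) by decide)
  have rtu := rho_rel ρ (show ct * cu = cu * ct by decide)
  simp only [map_mul, Module.End.mul_apply] at rat rbu
  obtain ⟨v, hv, -, h1⟩ := ex_fix a3 (fun _ => True) (fun _ _ => trivial) v hv trivial
  obtain ⟨v, hv, h1, h2⟩ := ex_fix b3 (fun w => ρ ca w = w)
    (fun w hw => by rw [map_sub, rab, hw]) v hv h1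
  obtain ⟨v, hv, h1, h2⟩ := ex_sgn t2 (fun w => ρ ca w = w ∧ ρ cb w = w)
    (fun w hw => ⟨by rw [map_add, rat, hw.1, hw.1], by rw [map_add, rbt, hw.2]⟩) v hv ⟨h1, h2⟩
  refine ex_sgn u2 (fun w => (ρ ca w = w ∧ ρ cb w = w) ∧ (ρ ct w = w ∨ ρ ct w = -w))
    (fun w hw => ⟨⟨by rw [map_add, rau, hw.1.1], by rw [map_add, rbu, hw.1.2, hw.1.2]⟩, ?_⟩)
    v hv ⟨h1, h2⟩
  rcases hw.2 with h | h
  · left; rw [map_add, rtu, h]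
  · right; rw [map_add, rtu, h, map_neg, neg_add]

/-- sign twist -/
noncomputable def tws (ρ : Equiv.Perm (Fin 6) →* (V →ₗ[k] V)) :
    Equiv.Perm (Fin 6) →* (V →ₗ[k] V) where
  toFun g := (((Equiv.Perm.sign g : ℤˣ) : ℤ) : k) • ρ g
  map_one' := by simp
  map_mul' g h := by
    rw [map_mul, map_mul, Units.val_mul, Int.cast_mul, smul_mul_smul_comm]

omit [CharP k 3] in
lemma tws_apply (ρ : Equiv.Perm (Fin 6) →* (V →ₗ[k] V)) (g : Equiv.Perm (Fin 6)) (v : V) :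
    tws ρ g v = (((Equiv.Perm.sign g : ℤˣ) : ℤ) : k) • ρ g v := rfl

omit [CharP k 3] in
lemma tws_even (ρ : Equiv.Perm (Fin 6) →* (V →ₗ[k] V)) {g : Equiv.Perm (Fin 6)}
    (h : Equiv.Perm.sign g = 1) (v : V) : tws ρ g v = ρ g v := by
  rw [tws_apply, h]; simp

omit [CharP k 3] in
lemma tws_odd (ρ : Equiv.Perm (Fin 6) →* (V →ₗ[k] V)) {g : Equiv.Perm (Fin 6)}
    (h : Equiv.Perm.sign g = -1) (v : V) : tws ρ g v = -ρ g v := by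
  rw [tws_apply, h]; simp

omit [CharP k 3] in
lemma tws_irr {ρ : Equiv.Perm (Fin 6) →* (V →ₗ[k] V)} (hi : Irr ρ) : Irr (tws ρ) := by
  intro U hU
  refine hi U fun g u hu => ?_
  have h := hU g u hu
  rcases Int.units_eq_one_or (Equiv.Perm.sign g) with e | e
  · rwa [tws_even ρ e] at h
  · rw [tws_odd ρ e] at h; simpa using neg_mem h

lemma sgn_a : Equiv.Perm.sign ca = 1 := by decide +kernel
lemma sgn_b : Equiv.Perm.sign cb = 1 := by decide +kernel
lemma sgn_t : Equiv.Perm.sign ct = -1 := by decide +kernel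
lemma sgn_u : Equiv.Perm.sign cu = -1 := by decide +kernel

omit [CharP k 3] in
lemma tws_typ {ρ : Equiv.Perm (Fin 6) →* (V →ₗ[k] V)} {d : ℕ} {α : Bool → ℕ → ℕ → ℕ}
    (h : Typ (tws ρ) d α) : Typ ρ d α := by
  obtain ⟨b, hb⟩ := h
  refine ⟨b, fun c j => ?_⟩
  rw [← hb c j]
  cases c
  · exact (tws_even ρ sgn_a _).symm
  · exact (tws_even ρ sgn_b _).symm

lemma classify [Nontrivial V] {ρ : Equiv.Perm (Fin 6) →* (V →ₗ[k] V)} (hi : Irr ρ) : Cls ρ := by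
  obtain ⟨v, hv, ⟨⟨ha, hb⟩, ht⟩, hu⟩ := ex_vec ρ
  rcases hu with hu | hu
  · rcases ht with ht | ht
    · exact cls_A hi hv ha hb hu ht
    · exact cls_C hi hv ha hb hu ht
  · have ha' : tws ρ ca v = v := by rw [tws_even ρ sgn_a, ha]
    have hb' : tws ρ cb v = v := by rw [tws_even ρ sgn_b, hb]
    have hu' : tws ρ cu v = v := by rw [tws_odd ρ sgn_u, hu, neg_neg]
    have h : Cls (tws ρ) := by
      rcases ht with ht | ht
      · exact cls_C (tws_irr hi) hv ha' hb' hu' (by rw [tws_odd ρ sgn_t, ht])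
      · exact cls_A (tws_irr hi) hv ha' hb' hu' (by rw [tws_odd ρ sgn_t, ht, neg_neg])
    exact h.imp tws_typ (Or.imp tws_typ (Or.imp tws_typ tws_typ))
end
end AlgMod
namespace AlgMod
lemma resO_tensorPow {k G Γ : Type} [Field k] [Group G] [Monoid Γ] (φ : Γ →* G) (M : FDRep k G) (n : ℕ) :
    Nonempty (resO φ (tensorPow M n) ≅ tensorPow (resO φ M) n) := by
  induction n with
  | zero => exact ⟨Iso.refl _⟩
  | succ n ih =>
    obtain ⟨e⟩ := ih
    have h : resO φ (tensorPow M n ⊗ M) ≅ resO φ (tensorPow M n) ⊗ resO φ M := Iso.refl _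
    exact ⟨h ≪≫ whiskerRightIso e _⟩

lemma exists_K (k : Type) [Field k] [CharP k 3] : ∃ (K : Type) (_ : Field K) (_ : Algebra k K),
    FiniteDimensional k K ∧ CharP K 3 ∧ ∃ ι : K, ι * ι = -1 := by
  let f : Polynomial k := Polynomial.X ^ 2 + 1
  refine ⟨f.SplittingField, inferInstance, inferInstance, inferInstance,
    charP_of_injective_algebraMap (algebraMap k f.SplittingField).injective 3, ?_⟩
  have hd : f.natDegree = 2 := by 
    have := Polynomial.natDegree_X_pow_add_C (n := 2) (r := (1 : k))
    simpa [f] using this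
  have h2 : (f.map (algebraMap k f.SplittingField)).degree ≠ 0 := by
    rw [Polynomial.degree_map]
    intro h
    have := Polynomial.natDegree_eq_zero_iff_degree_le_zero.2 h.le
    omega
  obtain ⟨ι, h⟩ := (Polynomial.SplittingField.splits f).exists_eval_eq_zero h2
  refine ⟨ι, ?_⟩
  simp only [f, Polynomial.map_add, Polynomial.map_pow, Polynomial.map_X, Polynomial.map_one,
    Polynomial.eval_add, Polynomial.eval_pow, Polynomial.eval_X, Polynomial.eval_one] at h
  linear_combination h

theorem alg_of_types (k : Type) [Field k] [CharP k 3] (M : FDRep k (Equiv.Perm (Fin 6)))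
    (h : HasB (resO phi M) 1 ty1 ∨ HasB (resO phi M) 4 ty4 ∨ HasB (resO phi M) 6 ty6 ∨
      HasB (resO phi M) 9 ty9) : IsAlgebraic M := by
  obtain ⟨K, _, _, _, _, ι, hι⟩ := exists_K k
  have k1 : KeyRel (Wm ι 3) (Wm ι 6) := key_rel hι (by simp)
  have k2 : KeyRel (Wm ι 6) (Wm ι 3) := key_rel hι (by simp)
  have h0 := types_inAdd (K := K) hι h
  refine isAlgebraic_of_inAdd M ((List.range 5).flatMap fun i => (List.range 5).map fun j =>
    coind phi ((rsF k).obj (pw (Wm ι 3) i ⊗ pw (Wm ι 6) j))) fun n => ?_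
  obtain ⟨e⟩ := resO_tensorPow phi M n
  have h2 := bc_tensorPow (resO phi M) (Fam (Wm ι 3) (Wm ι 6)) h0
    (fun X hX => fam_mul k1 k2 h0 (InAdd.of hX)) n
  have h3 := higman sylH phi sylH_phi (sylH_index k) (h2.iso e)
  refine InAdd.trans ?_ h3
  rintro _ ⟨_, ⟨_, ⟨i, hi, j, hj, rfl⟩, rfl⟩, rfl⟩
  refine InAdd.of ?_
  simp only [List.mem_flatMap, List.mem_map, List.mem_range]
  exact ⟨i, by omega, j, by omega, rfl⟩
end AlgMod
namespace AlgMod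
lemma irr_of_simple {k : Type} [Field k] (M : FDRep k (Equiv.Perm (Fin 6))) (hM : Simple M) :
    Irr (k := k) (V := M) M.ρ := by
  intro U hU
  by_cases h0 : U = ⊥
  · exact Or.inl h0
  right
  let σ : Representation k (Equiv.Perm (Fin 6)) U :=
    { toFun := fun g => (M.ρ g).restrict (hU g)
      map_one' := by ext v; simp
      map_mul' := by intro a b; ext v; simp }
  let i : FDRep.of σ ⟶ M := mkHom U.subtype (fun g v => rfl)
  have hi : Mono i := by
    refine ⟨fun f g h => lin_inj ?_⟩
    ext v
    have h2 := congrArg (fun z => lin z v) h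
    exact h2
  have hn : i ≠ 0 := by
    intro h
    apply h0
    rw [eq_bot_iff]
    intro u hu
    have h2 := congrArg (fun z : FDRep.of σ ⟶ M => lin z (⟨u, hu⟩ : U)) h
    exact h2
  have := (Simple.mono_isIso_iff_nonzero i).2 hn
  rw [eq_top_iff]
  intro u _
  have h2 : lin (inv i ≫ i) u = u := by rw [IsIso.inv_hom_id]; rfl
  have h3 : lin (inv i ≫ i) u = ((lin (inv i) u : U) : M) := rfl
  rw [← h2, h3]
  exact Subtype.property _

lemma nontrivial_of_simple {k : Type} [Field k] (M : FDRep k (Equiv.Perm (Fin 6)))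
    (hM : Simple M) : Nontrivial M := by
  by_contra h
  rw [not_nontrivial_iff_subsingleton] at h
  apply Simple.not_isZero M
  rw [Limits.IsZero.iff_id_eq_zero]
  apply lin_inj
  ext v
  exact Subsingleton.elim (α := M) _ _

lemma hasB_of_typ {k : Type} [Field k] (M : FDRep k (Equiv.Perm (Fin 6))) {d : ℕ}
    {α : Bool → ℕ → ℕ → ℕ} (h : Typ (k := k) (V := M) M.ρ d α) : HasB (resO phi M) d α := by
  obtain ⟨b, hb⟩ := h
  exact ⟨b, fun c j => hb c j⟩
end AlgMod


/-- Every simple module in characteristic `3` for `Equiv.Perm (Fin 6)` is algebraic. -/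
theorem sym6_char3_simple_algebraic (k : Type) [Field k] (hk : CharP k 3)
    (M : FDRep k (Equiv.Perm (Fin 6))) (hM : Simple M) : IsAlgebraic M := by
  have := hk
  have := AlgMod.nontrivial_of_simple M hM
  refine AlgMod.alg_of_types k M ?_
  have h := AlgMod.classify (AlgMod.irr_of_simple M hM)
  exact h.imp (AlgMod.hasB_of_typ M) (Or.imp (AlgMod.hasB_of_typ M)
    (Or.imp (AlgMod.hasB_of_typ M) (AlgMod.hasB_of_typ M)))
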